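/- arXiv:2205.08945 — 17 statements merged into one kernel-verified Lean document; each statement's English description precedes it below -/
import Mathlib

section
/- Let R be a ring and let E be an injective hull of R as a right R-module. Then the following are equivalent: (a) every simple right R-module is a homomorphic image of some injective right R-module; (b) every simple right R-module is a homomorphic image of E. -/
/-!
STATEMENT 1: Let `R` be a ring and `E` an injective hull of `R` as a right `R`-module.
Then: every simple right `R`-module is a homomorphic image of some injective right
`R`-module (i.e. `R` is right dual Kasch) if and only if every simple right `R`-module
is a homomorphic image of `E`. Right `R`-modules are formalized as `Rᵐᵒᵖ`-modules.
-/

universe u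

/-- A ring `R` is right dual Kasch if every simple right `R`-module is a homomorphic
image of an injective right `R`-module. -/
def RightDualKasch (R : Type u) [Ring R] : Prop :=
  ∀ (S : Type u) [AddCommGroup S] [Module Rᵐᵒᵖ S], IsSimpleModule Rᵐᵒᵖ S →
    ∃ (Q : Type u) (_ : AddCommGroup Q) (_ : Module Rᵐᵒᵖ Q),
      Module.Injective Rᵐᵒᵖ Q ∧ ∃ f : Q →ₗ[Rᵐᵒᵖ] S, Function.Surjective f

theorem rightDualKasch_iff_simple_image_of_injective_hull
    (R : Type u) [Ring R] (E : Type u) [AddCommGroup E] [Module Rᵐᵒᵖ E]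
    (hE : Module.Injective Rᵐᵒᵖ E) (i : R →ₗ[Rᵐᵒᵖ] E) (hi : Function.Injective i)
    (hess : ∀ K : Submodule Rᵐᵒᵖ E, K ≠ ⊥ → K ⊓ LinearMap.range i ≠ ⊥) :
    RightDualKasch R ↔
      (∀ (S : Type u) [AddCommGroup S] [Module Rᵐᵒᵖ S], IsSimpleModule Rᵐᵒᵖ S →
        ∃ f : E →ₗ[Rᵐᵒᵖ] S, Function.Surjective f) := by
  constructor
  · intro h S _ _ hS
    obtain ⟨Q, _, _, hQ, f, hf⟩ := h S hS
    haveI := IsSimpleModule.nontrivial Rᵐᵒᵖ S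
    obtain ⟨s, hs⟩ := exists_ne (0 : S)
    obtain ⟨q, rfl⟩ := hf s
    let g : R →ₗ[Rᵐᵒᵖ] Q :=
      { toFun := fun r => MulOpposite.op r • q
        map_add' := fun a b => by rw [MulOpposite.op_add, add_smul]
        map_smul' := fun a b => by
          simp only [RingHom.id_apply, smul_smul]
          rfl }
    obtain ⟨k, hk⟩ := hQ.out i hi g
    refine ⟨f ∘ₗ k, ?_⟩
    refine LinearMap.surjective_of_ne_zero ?_
    intro h0
    apply hs
    have h1 := LinearMap.congr_fun h0 (i 1)
    have h2 : g 1 = q := one_smul Rᵐᵒᵖ q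
    simpa [hk, h2] using h1
  · intro h S _ _ hS
    exact ⟨E, inferInstance, inferInstance, hE, h S hS⟩
end

section
/- If R and S are Morita equivalent rings, then R is right dual Kasch if and only if S is right dual Kasch. -/
/-!
STATEMENT 2: If `R` and `S` are Morita equivalent rings, then `R` is right dual Kasch
if and only if `S` is right dual Kasch. Morita equivalence is formalized as an
equivalence between the categories of right modules (modules over the opposite rings).
-/

universe u

open CategoryTheory

/-- Two rings are Morita equivalent if their categories of right modules are equivalent. -/
def MoritaEquivalent (R S : Type u) [Ring R] [Ring S] : Prop :=
  Nonempty (ModuleCat.{u} Rᵐᵒᵖ ≌ ModuleCat.{u} Sᵐᵒᵖ)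

theorem rightDualKasch_of_equivalence (R S : Type u) [Ring R] [Ring S]
    (e : ModuleCat.{u} Rᵐᵒᵖ ≌ ModuleCat.{u} Sᵐᵒᵖ) (hR : RightDualKasch R) :
    RightDualKasch S := by
  intro T _ _ hT
  have hs : Simple (ModuleCat.of Sᵐᵒᵖ T) := simple_iff_isSimpleModule.mpr hT
  have hs2 : Simple (e.inverse.obj (ModuleCat.of Sᵐᵒᵖ T)) := by
    have : Simple (e.functor.obj (e.inverse.obj (ModuleCat.of Sᵐᵒᵖ T))) :=
      Simple.of_iso (Y := ModuleCat.of Sᵐᵒᵖ T) (e.counitIso.app (ModuleCat.of Sᵐᵒᵖ T))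
    have hm : e.functor.PreservesMonomorphisms :=
      Functor.preservesMonomorphisms_of_adjunction e.symm.toAdjunction
    have hz : e.functor.PreservesZeroMorphisms := Functor.preservesZeroMorphisms_of_full _
    exact e.functor.simple_of_simple_obj _
  have hsm : IsSimpleModule Rᵐᵒᵖ (e.inverse.obj (ModuleCat.of Sᵐᵒᵖ T)) :=
    (simple_iff_isSimpleModule' _).mp hs2
  obtain ⟨Q, _, _, hQ, f, hf⟩ := hR _ hsm
  have hQ' : Injective (ModuleCat.of Rᵐᵒᵖ Q) := (Module.injective_iff_injective_object Rᵐᵒᵖ Q).mp hQ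
  have hQ2 : Injective (e.functor.obj (ModuleCat.of Rᵐᵒᵖ Q)) :=
    (e.map_injective_iff _).mpr hQ'
  refine ⟨e.functor.obj (ModuleCat.of Rᵐᵒᵖ Q), inferInstance, inferInstance,
    (Module.injective_iff_injective_object Sᵐᵒᵖ _).mpr hQ2, ?_⟩
  have hE : Epi (ModuleCat.ofHom f : ModuleCat.of Rᵐᵒᵖ Q ⟶ e.inverse.obj (ModuleCat.of Sᵐᵒᵖ T)) :=
    (ModuleCat.epi_iff_surjective _).mpr hf
  have hE1 : e.functor.PreservesEpimorphisms :=
    Functor.preservesEpimorphisms_of_adjunction e.toAdjunction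
  have hE2 : Epi (e.functor.map (ModuleCat.ofHom f : ModuleCat.of Rᵐᵒᵖ Q ⟶
      e.inverse.obj (ModuleCat.of Sᵐᵒᵖ T)) ≫ e.counit.app (ModuleCat.of Sᵐᵒᵖ T)) := inferInstance
  exact ⟨_, (ModuleCat.epi_iff_surjective _).mp hE2⟩

theorem rightDualKasch_of_moritaEquivalent (R S : Type u) [Ring R] [Ring S]
    (h : MoritaEquivalent R S) : RightDualKasch R ↔ RightDualKasch S := by
  obtain ⟨e⟩ := h
  exact ⟨rightDualKasch_of_equivalence R S e, rightDualKasch_of_equivalence S R e.symm⟩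
end

section
/- Let R be a right dual Kasch ring, let P be a finitely generated projective right R-module, and let E be an injective hull of P. Then P is a coneat submodule of E, i.e. for every simple right R-module S, every R-linear map P → S extends to an R-linear map E → S. -/
/-!
STATEMENT 3: Let `R` be a right dual Kasch ring, `P` a finitely generated projective
right `R`-module and `E` an injective hull of `P`. Then `P` is coneat in `E`: for every
simple right `R`-module `S`, every `R`-linear map `P → S` extends to `E → S`.
Right `R`-modules are formalized as `Rᵐᵒᵖ`-modules.
-/

universe u

theorem coneat_in_injective_hull_of_rightDualKasch
    (R : Type u) [Ring R] (hR : RightDualKasch R)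
    (P : Type u) [AddCommGroup P] [Module Rᵐᵒᵖ P]
    (hfg : Module.Finite Rᵐᵒᵖ P) (hproj : Module.Projective Rᵐᵒᵖ P)
    (E : Type u) [AddCommGroup E] [Module Rᵐᵒᵖ E]
    (hE : Module.Injective Rᵐᵒᵖ E) (i : P →ₗ[Rᵐᵒᵖ] E) (hi : Function.Injective i)
    (hess : ∀ K : Submodule Rᵐᵒᵖ E, K ≠ ⊥ → K ⊓ LinearMap.range i ≠ ⊥)
    (S : Type u) [AddCommGroup S] [Module Rᵐᵒᵖ S] (hS : IsSimpleModule Rᵐᵒᵖ S)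
    (f : P →ₗ[Rᵐᵒᵖ] S) :
    ∃ g : E →ₗ[Rᵐᵒᵖ] S, ∀ x : P, g (i x) = f x := by
  obtain ⟨Q, _, _, hQ, q, hq⟩ := hR S hS
  obtain ⟨h, hh⟩ := Module.projective_lifting_property q f hq
  obtain ⟨k, hk⟩ := hQ.out i hi h
  refine ⟨q.comp k, fun x => ?_⟩
  rw [LinearMap.comp_apply, hk, ← hh, LinearMap.comp_apply]
end

section
/- Let R be a ring and let E be an injective hull of R as a right R-module. Then R is right dual Kasch if and only if R is a coclosed submodule of E. -/
/-!
STATEMENT 4: Let `R` be a ring and `E` an injective hull of `R` as a right `R`-module.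
Then `R` is right dual Kasch if and only if `R` is a coclosed submodule of `E`.
`R` is identified with the range of the essential embedding `i : R → E`; a submodule
`N` of `E` is coclosed if for every submodule `K ≤ N` such that `N/K` is small
(superfluous) in `E/K`, one has `K = N`. Right `R`-modules are `Rᵐᵒᵖ`-modules.
-/

universe u

/-- The linear map from `R` sending `1` to `q`. -/
def rightFrom (R : Type u) [Ring R] {Q : Type u} [AddCommGroup Q] [Module Rᵐᵒᵖ Q] (q : Q) :
    R →ₗ[Rᵐᵒᵖ] Q where
  toFun r := MulOpposite.op r • q
  map_add' a b := by rw [MulOpposite.op_add, add_smul]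
  map_smul' a b := by
    induction a using MulOpposite.rec' with
    | h a => simp [mul_smul]

theorem right_span_one (R : Type u) [Ring R] : Submodule.span Rᵐᵒᵖ {(1 : R)} = ⊤ := by
  rw [eq_top_iff]
  intro r _
  rw [Submodule.mem_span_singleton]
  exact ⟨MulOpposite.op r, by simp⟩

theorem right_finite (R : Type u) [Ring R] : Module.Finite Rᵐᵒᵖ R :=
  ⟨⟨{1}, by simpa using right_span_one R⟩⟩

theorem rightDualKasch_iff_coclosed_in_injective_hull
    (R : Type u) [Ring R] (E : Type u) [AddCommGroup E] [Module Rᵐᵒᵖ E]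
    (hE : Module.Injective Rᵐᵒᵖ E) (i : R →ₗ[Rᵐᵒᵖ] E) (hi : Function.Injective i)
    (hess : ∀ K : Submodule Rᵐᵒᵖ E, K ≠ ⊥ → K ⊓ LinearMap.range i ≠ ⊥) :
    RightDualKasch R ↔
      (∀ K : Submodule Rᵐᵒᵖ E, K ≤ LinearMap.range i →
        -- `(range i)/K` is small in `E/K`:
        (∀ X : Submodule Rᵐᵒᵖ (E ⧸ K),
          (LinearMap.range i).map K.mkQ ⊔ X = ⊤ → X = ⊤) →
        K = LinearMap.range i) := by
  constructor
  · intro hR K hK hsmall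
    by_contra hne
    have hc : K.comap i ≠ ⊤ := by
      intro h
      apply hne
      refine le_antisymm hK ?_
      rintro _ ⟨r, rfl⟩
      have : r ∈ K.comap i := by rw [h]; trivial
      exact this
    haveI := right_finite R
    obtain ⟨M, hM, hKM⟩ := (eq_top_or_exists_le_coatom (K.comap i)).resolve_left hc
    have hS : IsSimpleModule Rᵐᵒᵖ (R ⧸ M) := isSimpleModule_iff_isCoatom.mpr hM
    obtain ⟨Q, _, _, hQ, f, hf⟩ := hR (R ⧸ M) hS
    obtain ⟨q, hq⟩ := hf (M.mkQ 1)
    obtain ⟨g, hg⟩ := hQ.out i hi (rightFrom R q)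
    have hfg : ∀ r, f (g (i r)) = M.mkQ r := by
      intro r
      rw [hg]
      change f (MulOpposite.op r • q) = _
      rw [map_smul, hq, ← map_smul]
      simp
    have hKk : K ≤ LinearMap.ker (f ∘ₗ g) := by
      intro x hx
      obtain ⟨r, rfl⟩ := hK hx
      rw [LinearMap.mem_ker, LinearMap.comp_apply, hfg]
      simpa using hKM hx
    have htop := hsmall ((LinearMap.ker (f ∘ₗ g)).map K.mkQ) (by
      rw [← Submodule.map_sup, eq_top_iff]
      intro y _
      obtain ⟨x, rfl⟩ := K.mkQ_surjective y
      refine Submodule.mem_map_of_mem ?_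
      obtain ⟨r, hr⟩ := M.mkQ_surjective (f (g x))
      refine Submodule.mem_sup.mpr ⟨i r, ⟨r, rfl⟩, x - i r, ?_, by abel⟩
      rw [LinearMap.mem_ker, LinearMap.comp_apply, map_sub, map_sub, hfg, hr, sub_self])
    apply hM.1
    rw [eq_top_iff]
    intro r _
    have h1 : K.mkQ (i r) ∈ (LinearMap.ker (f ∘ₗ g)).map K.mkQ := by rw [htop]; trivial
    obtain ⟨z, hz, hzr⟩ := h1
    have h2 : i r - z ∈ K := by
      rw [← K.ker_mkQ, LinearMap.mem_ker, map_sub, hzr, sub_self]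
    have h3 : i r ∈ LinearMap.ker (f ∘ₗ g) := by
      have := add_mem (hKk h2) hz
      simpa using this
    rw [LinearMap.mem_ker, LinearMap.comp_apply, hfg] at h3
    simpa using h3
  · intro hco S _ _ hS
    haveI := hS
    haveI := IsSimpleModule.nontrivial Rᵐᵒᵖ S
    obtain ⟨s, hs⟩ := exists_ne (0 : S)
    have h1 : rightFrom R s 1 = s := by
      change MulOpposite.op (1 : R) • s = s
      simp
    have hp0 : rightFrom R s ≠ 0 := by
      intro h
      rw [h] at h1
      exact hs h1.symm
    have hp : Function.Surjective (rightFrom R s) := LinearMap.surjective_of_ne_zero hp0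
    have hM : IsCoatom (LinearMap.ker (rightFrom R s)) := by
      rw [← isSimpleModule_iff_isCoatom]
      exact IsSimpleModule.congr (LinearMap.quotKerEquivOfSurjective _ hp)
    have hKne : (LinearMap.ker (rightFrom R s)).map i ≠ LinearMap.range i := by
      intro h
      rw [LinearMap.range_eq_map] at h
      exact hM.1 (Submodule.map_injective_of_injective hi h)
    have hns := mt (hco _ LinearMap.map_le_range) hKne
    push Not at hns
    obtain ⟨X, hX, hXne⟩ := hns
    let K := (LinearMap.ker (rightFrom R s)).map i
    let π : E →ₗ[Rᵐᵒᵖ] ((E ⧸ K) ⧸ X) := X.mkQ ∘ₗ K.mkQ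
    have hπ : Function.Surjective π := X.mkQ_surjective.comp K.mkQ_surjective
    have hπi : Function.Surjective (π ∘ₗ i) := by
      intro y
      obtain ⟨z, rfl⟩ := X.mkQ_surjective y
      have hz : z ∈ (LinearMap.range i).map K.mkQ ⊔ X := by rw [hX]; trivial
      obtain ⟨_, ⟨_, ⟨r, rfl⟩, rfl⟩, x, hx, rfl⟩ := Submodule.mem_sup.mp hz
      refine ⟨r, ?_⟩
      have hx0 : X.mkQ x = 0 := by simpa using hx
      rw [map_add, hx0, add_zero]
      rfl
    have hle : LinearMap.ker (rightFrom R s) ≤ LinearMap.ker (π ∘ₗ i) := by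
      intro r hr
      have h0 : K.mkQ (i r) = 0 := by
        rw [← LinearMap.mem_ker, K.ker_mkQ]
        exact Submodule.mem_map_of_mem hr
      rw [LinearMap.mem_ker]
      change X.mkQ (K.mkQ (i r)) = 0
      rw [h0, map_zero]
    have hkne : LinearMap.ker (π ∘ₗ i) ≠ ⊤ := by
      intro h
      apply hXne
      rw [eq_top_iff]
      intro z _
      obtain ⟨r, hr⟩ := hπi (X.mkQ z)
      have h2 : r ∈ LinearMap.ker (π ∘ₗ i) := by rw [h]; trivial
      rw [LinearMap.mem_ker, hr] at h2
      simpa using h2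
    have heq : LinearMap.ker (π ∘ₗ i) ≤ LinearMap.ker (rightFrom R s) :=
      ((hM.le_iff.mp hle).resolve_left hkne).le
    let e := LinearMap.quotKerEquivOfSurjective (π ∘ₗ i) hπi
    let l := (LinearMap.ker (π ∘ₗ i)).liftQ (rightFrom R s) heq
    have hl : Function.Surjective l := by
      intro y
      obtain ⟨r, rfl⟩ := hp y
      exact ⟨(LinearMap.ker (π ∘ₗ i)).mkQ r, by simp [l]⟩
    exact ⟨E, inferInstance, inferInstance, hE, l ∘ₗ e.symm.toLinearMap ∘ₗ π,
      hl.comp (e.symm.surjective.comp hπ)⟩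
end

section
/- Let R be a right dual Kasch ring. Then every simple projective right R-module is injective. -/
/-!
STATEMENT 5: Over a right dual Kasch ring, every simple projective right module is
injective. Right `R`-modules are formalized as `Rᵐᵒᵖ`-modules.
-/

universe u

theorem injective_of_simple_projective_of_rightDualKasch
    (R : Type u) [Ring R] (hR : RightDualKasch R)
    (V : Type u) [AddCommGroup V] [Module Rᵐᵒᵖ V]
    (hsimple : IsSimpleModule Rᵐᵒᵖ V) (hproj : Module.Projective Rᵐᵒᵖ V) :
    Module.Injective Rᵐᵒᵖ V := by
  obtain ⟨Q, _, _, hQ, f, hf⟩ := hR V hsimple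
  obtain ⟨s, hs⟩ := Module.projective_lifting_property f LinearMap.id hf
  refine ⟨fun X Y _ _ _ _ i hi g => ?_⟩
  obtain ⟨h, hh⟩ := hQ.out i hi (s.comp g)
  refine ⟨f.comp h, fun x => ?_⟩
  rw [LinearMap.comp_apply, hh]
  exact LinearMap.congr_fun hs (g x)
end

section
/- Let R be a ring and let E be an injective hull of R as a right R-module. If E is retractable and R is right Kasch, then R is right dual Kasch. -/
/-!
STATEMENT 6: Let `R` be a ring and `E` an injective hull of `R` as a right `R`-module.
If `E` is retractable (for every nonzero submodule `K` of `E` there is a nonzero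
linear map `E → K`) and `R` is right Kasch, then `R` is right dual Kasch.
Right `R`-modules are formalized as `Rᵐᵒᵖ`-modules.
-/

universe u

/-- A ring `R` is right Kasch if every simple right `R`-module embeds into `R`. -/
def RightKasch (R : Type u) [Ring R] : Prop :=
  ∀ (S : Type u) [AddCommGroup S] [Module Rᵐᵒᵖ S], IsSimpleModule Rᵐᵒᵖ S →
    ∃ f : S →ₗ[Rᵐᵒᵖ] R, Function.Injective f

theorem rightDualKasch_of_rightKasch_of_retractable_hull
    (R : Type u) [Ring R] (E : Type u) [AddCommGroup E] [Module Rᵐᵒᵖ E]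
    (hE : Module.Injective Rᵐᵒᵖ E) (i : R →ₗ[Rᵐᵒᵖ] E) (hi : Function.Injective i)
    (hess : ∀ K : Submodule Rᵐᵒᵖ E, K ≠ ⊥ → K ⊓ LinearMap.range i ≠ ⊥)
    (hretr : ∀ K : Submodule Rᵐᵒᵖ E, K ≠ ⊥ → ∃ f : E →ₗ[Rᵐᵒᵖ] K, f ≠ 0)
    (hkasch : RightKasch R) : RightDualKasch R := by
  intro S _ _ hS
  obtain ⟨f, hf⟩ := hkasch S hS
  have hinj : Function.Injective (i ∘ₗ f) := by
    rw [LinearMap.coe_comp]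
    exact hi.comp hf
  let e := LinearEquiv.ofInjective (i ∘ₗ f) hinj
  have hK : LinearMap.range (i ∘ₗ f) ≠ ⊥ := by
    intro h
    obtain ⟨x, hx⟩ := @exists_ne S (IsSimpleModule.nontrivial Rᵐᵒᵖ S) 0
    have h0 : i ∘ₗ f = 0 := LinearMap.range_eq_bot.mp h
    exact hx (hinj (by rw [h0]; simp))
  obtain ⟨g, hg⟩ := hretr _ hK
  refine ⟨E, inferInstance, inferInstance, hE, e.symm.toLinearMap ∘ₗ g, ?_⟩
  apply LinearMap.surjective_of_ne_zero
  intro h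
  apply hg
  ext1 x
  have hx := LinearMap.congr_fun h x
  simpa using hx
end

section
/- Let R be a ring and let E be an injective hull of R as a right R-module. If E is coretractable and R is right dual Kasch, then R is right Kasch. -/
/-!
STATEMENT 7: Let `R` be a ring and `E` an injective hull of `R` as a right `R`-module.
If `E` is coretractable (for every proper submodule `K` of `E` there is a nonzero
linear map `E/K → E`) and `R` is right dual Kasch, then `R` is right Kasch.
Right `R`-modules are formalized as `Rᵐᵒᵖ`-modules.
-/

universe u

theorem rightKasch_of_rightDualKasch_of_coretractable_hull
    (R : Type u) [Ring R] (E : Type u) [AddCommGroup E] [Module Rᵐᵒᵖ E]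
    (hE : Module.Injective Rᵐᵒᵖ E) (i : R →ₗ[Rᵐᵒᵖ] E) (hi : Function.Injective i)
    (hess : ∀ K : Submodule Rᵐᵒᵖ E, K ≠ ⊥ → K ⊓ LinearMap.range i ≠ ⊥)
    (hcoretr : ∀ K : Submodule Rᵐᵒᵖ E, K ≠ ⊤ → ∃ f : (E ⧸ K) →ₗ[Rᵐᵒᵖ] E, f ≠ 0)
    (hdk : RightDualKasch R) : RightKasch R := by
  intro S _ _ hS
  obtain ⟨Q, _, _, hQ, f, hf⟩ := hdk S hS
  have hnt : Nontrivial S := IsSimpleModule.nontrivial Rᵐᵒᵖ S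
  obtain ⟨s, hs⟩ := exists_ne (0 : S)
  obtain ⟨q, hq⟩ := hf s
  let m : R →ₗ[Rᵐᵒᵖ] Q :=
    { toFun := fun r => MulOpposite.op r • q
      map_add' := fun a b => by rw [MulOpposite.op_add, add_smul]
      map_smul' := fun a b => by
        simp only [RingHom.id_apply, smul_smul]
        rfl }
  obtain ⟨g, hg⟩ := hQ.out i hi m
  have hne : f ∘ₗ g ≠ 0 := by
    intro h0
    apply hs
    have h1 := LinearMap.congr_fun h0 (i 1)
    rw [LinearMap.comp_apply, hg] at h1
    simpa [m, hq] using h1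
  have hsurj : Function.Surjective (f ∘ₗ g) := LinearMap.surjective_of_ne_zero hne
  have hK : LinearMap.ker (f ∘ₗ g) ≠ ⊤ := fun h => hne (LinearMap.ker_eq_top.mp h)
  obtain ⟨k, hk⟩ := hcoretr _ hK
  let e := (f ∘ₗ g).quotKerEquivOfSurjective hsurj
  let φ : S →ₗ[Rᵐᵒᵖ] E := k ∘ₗ e.symm.toLinearMap
  have hφ : φ ≠ 0 := by
    intro h0
    apply hk
    refine LinearMap.ext fun x => ?_
    simpa [φ] using LinearMap.congr_fun h0 (e x)
  have hinj : Function.Injective φ := LinearMap.injective_of_ne_zero hφ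
  have hr : LinearMap.range φ ≠ ⊥ := fun h => hφ (LinearMap.range_eq_bot.mp h)
  have hc : (LinearMap.range i).comap φ = ⊤ := by
    refine (eq_bot_or_eq_top _).resolve_left fun hb => hess _ hr ?_
    rw [eq_bot_iff]
    rintro _ ⟨⟨x, rfl⟩, hx⟩
    have hx' : x ∈ (LinearMap.range i).comap φ := hx
    rw [hb, Submodule.mem_bot] at hx'
    simp [hx']
  have hmem : ∀ x, φ x ∈ LinearMap.range i := fun x => by
    have : x ∈ (LinearMap.range i).comap φ := hc ▸ Submodule.mem_top
    exact this
  refine ⟨(LinearEquiv.ofInjective i hi).symm.toLinearMap ∘ₗ φ.codRestrict _ hmem, ?_⟩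
  intro x y hxy
  apply hinj
  have := (LinearEquiv.ofInjective i hi).symm.injective hxy
  exact congrArg Subtype.val this
end

section
/- Let k be a field and let R be a finite-dimensional k-algebra. Then R is right dual Kasch if and only if R is left Kasch, i.e. every simple left R-module is isomorphic to a submodule of R viewed as a left R-module. -/
/-!
STATEMENT 9: Let `k` be a field and `R` a finite-dimensional `k`-algebra. Then `R` is
right dual Kasch if and only if `R` is left Kasch (every simple left `R`-module embeds
into `R` as a left `R`-module). Right `R`-modules are formalized as `Rᵐᵒᵖ`-modules,
left `R`-modules as `R`-modules.
-/

universe u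

/-- A ring `R` is left Kasch if every simple left `R`-module embeds into `R`. -/
def LeftKasch (R : Type u) [Ring R] : Prop :=
  ∀ (S : Type u) [AddCommGroup S] [Module R S], IsSimpleModule R S →
    ∃ f : S →ₗ[R] R, Function.Injective f

set_option linter.style.haveILetI false
section helpers

universe v

/-- The dual of an `A`-module as a module over the opposite algebra `B`. -/
@[reducible] noncomputable def dualMod {k A B : Type v} [Field k] [Ring A] [Algebra k A] [Ring B]
    [Algebra k B] (e : B →ₐ[k] Aᵐᵒᵖ) (M : Type v) [AddCommGroup M] [Module k M] [Module A M]
    [IsScalarTower k A M] : Module B (Module.Dual k M) where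
  smul b φ := φ ∘ₗ Algebra.lsmul k k M (e b).unop
  one_smul φ := by
    ext m
    change φ ((e 1).unop • m) = φ m
    simp
  mul_smul b c φ := by
    ext m
    change φ ((e (b * c)).unop • m) = φ ((e c).unop • (e b).unop • m)
    simp [mul_smul]
  smul_zero b := by
    ext m
    rfl
  smul_add b φ ψ := by
    ext m
    rfl
  add_smul b c φ := by
    ext m
    change φ ((e (b + c)).unop • m) = φ ((e b).unop • m) + φ ((e c).unop • m)
    simp [add_smul]
  zero_smul φ := by
    ext m
    change φ ((e 0).unop • m) = 0
    simp

theorem dual_simple {k A B : Type v} [Field k] [Ring A] [Algebra k A] [Ring B]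
    (M : Type v) [AddCommGroup M] [Module k M] [Module A M]
    [IsScalarTower k A M] [FiniteDimensional k M] [IsSimpleModule A M]
    [Module B (Module.Dual k M)]
    (h : ∀ a : A, ∃ b : B, ∀ (φ : Module.Dual k M) (m : M), (b • φ) m = φ (a • m)) :
    IsSimpleModule B (Module.Dual k M) := by
  have : Nontrivial M := IsSimpleModule.nontrivial A M
  rw [isSimpleModule_iff]
  refine { eq_bot_or_eq_top := fun N => ?_ }
  let N' : Submodule k (Module.Dual k M) :=
    { carrier := N
      add_mem' := fun ha hb => N.add_mem ha hb
      zero_mem' := N.zero_mem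
      smul_mem' := fun c φ hφ => by
        obtain ⟨b, hb⟩ := h (algebraMap k A c)
        have : c • φ = b • φ := by
          ext m
          rw [hb, algebraMap_smul]
          simp
        rw [this]
        exact N.smul_mem b hφ }
  let C : Submodule A M :=
    { carrier := N'.dualCoannihilator
      add_mem' := fun ha hb => N'.dualCoannihilator.add_mem ha hb
      zero_mem' := N'.dualCoannihilator.zero_mem
      smul_mem' := fun a m hm => by
        simp only [SetLike.mem_coe, Submodule.mem_dualCoannihilator] at hm ⊢
        intro φ hφ
        obtain ⟨b, hb⟩ := h a
        rw [← hb]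
        exact hm _ (N.smul_mem b hφ) }
  have key : N'.dualCoannihilator.dualAnnihilator = N' :=
    Subspace.dualCoannihilator_dualAnnihilator_eq
  rcases eq_bot_or_eq_top C with hC | hC
  · right
    have h1 : N'.dualCoannihilator = ⊥ := by
      ext m
      change m ∈ C ↔ _
      rw [hC]; simp
    rw [h1, Submodule.dualAnnihilator_bot] at key
    ext φ
    change φ ∈ N' ↔ _
    rw [← key]; simp
  · left
    have h1 : N'.dualCoannihilator = ⊤ := by
      ext m
      change m ∈ C ↔ _
      rw [hC]; simp
    rw [h1, Submodule.dualAnnihilator_top] at key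
    ext φ
    change φ ∈ N' ↔ _
    rw [← key]; simp

theorem finite_of_simple {k A : Type v} [Field k] [Ring A] [Algebra k A] [FiniteDimensional k A]
    (M : Type v) [AddCommGroup M] [Module k M] [Module A M]
    [IsScalarTower k A M] [IsSimpleModule A M] : FiniteDimensional k M :=
  Module.Finite.trans A M

theorem tower_compHom (k A : Type v) [Field k] [Ring A] [Algebra k A]
    (M : Type v) [AddCommGroup M] [Module A M] :
    letI : Module k M := Module.compHom M (algebraMap k A)
    IsScalarTower k A M := by
  letI : Module k M := Module.compHom M (algebraMap k A)
  refine ⟨fun c a m => ?_⟩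
  change (c • a) • m = algebraMap k A c • a • m
  rw [Algebra.smul_def, mul_smul]

open MulOpposite

theorem dual_injective (k R : Type v) [Field k] [Ring R] [Algebra k R] :
    letI : Module Rᵐᵒᵖ (Module.Dual k R) := dualMod (AlgHom.id k Rᵐᵒᵖ) R
    Module.Injective Rᵐᵒᵖ (Module.Dual k R) := by
  letI : Module Rᵐᵒᵖ (Module.Dual k R) := dualMod (AlgHom.id k Rᵐᵒᵖ) R
  have hs : ∀ (b : Rᵐᵒᵖ) (φ : Module.Dual k R) (m : R), (b • φ) m = φ (b.unop * m) :=
    fun _ _ _ => rfl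
  refine ⟨fun X Y _ _ _ _ f hf g => ?_⟩
  letI : Module k X := Module.compHom X (algebraMap k Rᵐᵒᵖ)
  haveI : IsScalarTower k Rᵐᵒᵖ X := tower_compHom k Rᵐᵒᵖ X
  letI : Module k Y := Module.compHom Y (algebraMap k Rᵐᵒᵖ)
  haveI : IsScalarTower k Rᵐᵒᵖ Y := tower_compHom k Rᵐᵒᵖ Y
  have hsc : ∀ (c : k) (φ : Module.Dual k R), algebraMap k Rᵐᵒᵖ c • φ = c • φ := by
    intro c φ
    ext m
    rw [hs]
    simp [← Algebra.smul_def]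
  let g0 : X →ₗ[k] k :=
    { toFun := fun x => g x 1
      map_add' := fun x y => by simp
      map_smul' := fun c x => by
        rw [← algebraMap_smul Rᵐᵒᵖ c x, map_smul, hsc]; rfl }
  let f0 : X →ₗ[k] Y := f.restrictScalars k
  obtain ⟨l, hl⟩ := f0.exists_leftInverse_of_injective (LinearMap.ker_eq_bot.2 hf)
  let G : Y →ₗ[k] k := g0 ∘ₗ l
  have hG : ∀ x, G (f x) = g x 1 := fun x => by
    have := LinearMap.congr_fun hl x
    change g0 (l (f0 x)) = _
    rw [LinearMap.comp_apply] at this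
    rw [this]; rfl
  refine ⟨{ toFun := fun y =>
              { toFun := fun r => G (op r • y)
                map_add' := fun r s => by simp [add_smul]
                map_smul' := fun c r => by simp [op_smul] }
            map_add' := fun x y => by ext r; simp
            map_smul' := fun b y => by
              ext r
              simp only [RingHom.id_apply, hs, LinearMap.coe_mk, AddHom.coe_mk]
              rw [smul_smul]; simp }, fun x => ?_⟩
  ext r
  change G (op r • f x) = g x r
  rw [← map_smul, hG, map_smul, hs]
  simp

theorem right_of_left (k R : Type v) [Field k] [Ring R] [Algebra k R] [FiniteDimensional k R]
    (H : LeftKasch R) : RightDualKasch R := by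
  intro T _ _ hT
  letI : Module k T := Module.compHom T (algebraMap k Rᵐᵒᵖ)
  haveI : IsScalarTower k Rᵐᵒᵖ T := tower_compHom k Rᵐᵒᵖ T
  haveI : FiniteDimensional k T := finite_of_simple (A := Rᵐᵒᵖ) T
  letI : Module Rᵐᵒᵖ (Module.Dual k R) := dualMod (AlgHom.id k Rᵐᵒᵖ) R
  have hs : ∀ (b : Rᵐᵒᵖ) (φ : Module.Dual k R) (m : R), (b • φ) m = φ (b.unop * m) :=
    fun _ _ _ => rfl
  letI : Module R (Module.Dual k T) := dualMod (AlgEquiv.opOp k R).toAlgHom T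
  have ht : ∀ (b : R) (φ : Module.Dual k T) (m : T), (b • φ) m = φ (op b • m) :=
    fun _ _ _ => rfl
  have hsimp : IsSimpleModule R (Module.Dual k T) :=
    dual_simple (A := Rᵐᵒᵖ) T (fun a => ⟨a.unop, fun φ m => rfl⟩)
  obtain ⟨h, hh⟩ := H (Module.Dual k T) hsimp
  refine ⟨Module.Dual k R, inferInstance, inferInstance, dual_injective k R, ?_⟩
  have hsc : ∀ (c : k) (φ : Module.Dual k T), algebraMap k R c • φ = c • φ := by
    intro c φ
    ext m
    rw [ht, ← MulOpposite.algebraMap_apply, algebraMap_smul]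
    simp
  let h0 : Module.Dual k T →ₗ[k] R :=
    { toFun := h
      map_add' := fun x y => by simp
      map_smul' := fun c x => by
        rw [← hsc, map_smul, smul_eq_mul, ← Algebra.smul_def]; rfl }
  let E := Module.evalEquiv k T
  have hE : ∀ (ξ) (ψ : Module.Dual k T), ψ (E.symm ξ) = ξ ψ := fun ξ ψ => by
    simp [E]
  let F : Module.Dual k R →ₗ[Rᵐᵒᵖ] T :=
    { toFun := fun φ => E.symm (φ ∘ₗ h0)
      map_add' := fun x y => by rw [LinearMap.add_comp, map_add]
      map_smul' := fun b φ => by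
        rw [← sub_eq_zero, ← Module.forall_dual_apply_eq_zero_iff k]
        intro ψ
        rw [map_sub, sub_eq_zero, hE]
        have := ht b.unop ψ (E.symm (φ ∘ₗ h0))
        rw [hE, op_unop] at this
        rw [RingHom.id_apply, ← this]
        change φ (b.unop * h ψ) = φ (h (b.unop • ψ))
        rw [map_smul]; rfl }
  refine ⟨F, LinearMap.surjective_of_ne_zero ?_⟩
  intro hF
  obtain ⟨ψ, hψ⟩ :=
      @exists_ne _ (IsSimpleModule.nontrivial R (Module.Dual k T)) (0 : Module.Dual k T)
  apply hψ
  apply hh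
  rw [map_zero, ← Module.forall_dual_apply_eq_zero_iff k]
  intro φ
  have h1 : E.symm (φ ∘ₗ h0) = 0 := LinearMap.congr_fun hF φ
  have h2 := hE (φ ∘ₗ h0) ψ
  rw [h1, map_zero] at h2
  exact h2.symm

theorem left_of_right (k R : Type v) [Field k] [Ring R] [Algebra k R] [FiniteDimensional k R]
    (H : RightDualKasch R) : LeftKasch R := by
  intro S _ _ hS
  letI : Module k S := Module.compHom S (algebraMap k R)
  haveI : IsScalarTower k R S := tower_compHom k R S
  haveI : FiniteDimensional k S := finite_of_simple (A := R) S
  letI : Module Rᵐᵒᵖ (Module.Dual k R) := dualMod (AlgHom.id k Rᵐᵒᵖ) R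
  have hs : ∀ (b : Rᵐᵒᵖ) (φ : Module.Dual k R) (m : R), (b • φ) m = φ (b.unop * m) :=
    fun _ _ _ => rfl
  letI : Module Rᵐᵒᵖ (Module.Dual k S) := dualMod (AlgHom.id k Rᵐᵒᵖ) S
  have ht : ∀ (b : Rᵐᵒᵖ) (φ : Module.Dual k S) (m : S), (b • φ) m = φ (b.unop • m) :=
    fun _ _ _ => rfl
  have hsimp : IsSimpleModule Rᵐᵒᵖ (Module.Dual k S) :=
    dual_simple (A := R) S (fun a => ⟨op a, fun φ m => rfl⟩)
  obtain ⟨Q, _, _, hQ, f, hf⟩ := H (Module.Dual k S) hsimp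
  letI : Module k Q := Module.compHom Q (algebraMap k Rᵐᵒᵖ)
  haveI : IsScalarTower k Rᵐᵒᵖ Q := tower_compHom k Rᵐᵒᵖ Q
  -- the coinduced module
  letI iS : SMul Rᵐᵒᵖ (R →ₗ[k] Q) := ⟨fun b φ => φ ∘ₗ LinearMap.mulLeft k b.unop⟩
  letI : Module Rᵐᵒᵖ (R →ₗ[k] Q) :=
    { toSMul := iS
      one_smul := fun φ => by
        ext m
        change φ (1 * m) = φ m
        rw [one_mul]
      mul_smul := fun b c φ => by
        ext m
        change φ ((c.unop * b.unop) * m) = φ (c.unop * (b.unop * m))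
        rw [mul_assoc]
      smul_zero := fun b => rfl
      smul_add := fun b φ ψ => rfl
      add_smul := fun b c φ => by
        ext m
        change φ ((b.unop + c.unop) * m) = φ (b.unop * m) + φ (c.unop * m)
        rw [add_mul, map_add]
      zero_smul := fun φ => by
        ext m
        change φ (0 * m) = 0
        rw [zero_mul, map_zero] }
  have hc : ∀ (b : Rᵐᵒᵖ) (φ : R →ₗ[k] Q) (m : R), (b • φ) m = φ (b.unop * m) :=
    fun _ _ _ => rfl
  let ι : Q →ₗ[Rᵐᵒᵖ] (R →ₗ[k] Q) :=
    { toFun := fun q =>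
        { toFun := fun r => op r • q
          map_add' := fun r s => by simp [add_smul]
          map_smul' := fun c r => by simp [op_smul] }
      map_add' := fun x y => by ext r; simp
      map_smul' := fun b y => by
        ext r
        simp only [RingHom.id_apply, hc, LinearMap.coe_mk, AddHom.coe_mk]
        rw [smul_smul]; simp }
  have hι : Function.Injective ι := by
    intro x y hxy
    have := LinearMap.congr_fun hxy 1
    simpa [ι] using this
  obtain ⟨r, hr⟩ := hQ.out ι hι LinearMap.id
  -- rank one maps
  let G : Q → Module.Dual k R →ₗ[Rᵐᵒᵖ] Module.Dual k S := fun q =>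
    { toFun := fun φ => f (r (φ.smulRight q))
      map_add' := fun φ ψ => by
        rw [← map_add, ← map_add]
        congr 2
        ext m
        simp [add_smul]
      map_smul' := fun b φ => by
        rw [RingHom.id_apply, ← map_smul, ← map_smul]
        rfl }
  have hG : ∃ q, G q ≠ 0 := by
    by_contra! hcon
    obtain ⟨ψ, hψ⟩ :=
      @exists_ne _ (IsSimpleModule.nontrivial Rᵐᵒᵖ (Module.Dual k S)) (0 : Module.Dual k S)
    obtain ⟨q, rfl⟩ := hf ψ
    apply hψ
    have h1 : q = r (ι q) := (hr q).symm
    let b := Module.finBasis k R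
    have h2 : ι q = ∑ i, (b.coord i).smulRight (ι q (b i)) := by
      apply b.ext
      intro j
      simp [LinearMap.sum_apply, Finsupp.single_apply]
    rw [h1, h2, map_sum, map_sum]
    exact Finset.sum_eq_zero fun i _ => LinearMap.congr_fun (hcon (ι q (b i))) (b.coord i)
  obtain ⟨q, hq⟩ := hG
  have hsc : ∀ (c : k) (φ : Module.Dual k R), algebraMap k Rᵐᵒᵖ c • φ = c • φ := by
    intro c φ
    ext m
    rw [hs]
    simp [← Algebra.smul_def]
  have hsc' : ∀ (c : k) (φ : Module.Dual k S), algebraMap k Rᵐᵒᵖ c • φ = c • φ := by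
    intro c φ
    ext m
    rw [ht]
    simp
  let g0 : Module.Dual k R →ₗ[k] Module.Dual k S :=
    { toFun := G q
      map_add' := fun x y => by rw [map_add]
      map_smul' := fun c x => by rw [← hsc, map_smul, hsc']; rfl }
  let E := Module.evalEquiv k R
  have hE : ∀ (ξ) (ψ : Module.Dual k R), ψ (E.symm ξ) = ξ ψ := fun ξ ψ => by
    simp [E]
  let F : S →ₗ[R] R :=
    { toFun := fun s => E.symm (g0.flip s)
      map_add' := fun x y => by rw [map_add, map_add]
      map_smul' := fun a s => by
        rw [← sub_eq_zero, ← Module.forall_dual_apply_eq_zero_iff k]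
        intro ψ
        rw [map_sub, sub_eq_zero, hE]
        have := hs (op a) ψ (E.symm (g0.flip s))
        rw [hE, unop_op] at this
        rw [RingHom.id_apply, smul_eq_mul, ← this]
        change G q ψ (a • s) = G q (op a • ψ) s
        rw [(G q).map_smul (op a) ψ]; rfl }
  refine ⟨F, LinearMap.injective_of_ne_zero ?_⟩
  intro hF
  apply hq
  ext φ s
  have h1 : E.symm (g0.flip s) = 0 := LinearMap.congr_fun hF s
  have h2 := hE (g0.flip s) φ
  rw [h1, map_zero] at h2
  exact h2.symm

end helpers

theorem rightDualKasch_iff_leftKasch_of_finiteDimensional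
    (k : Type u) [Field k] (R : Type u) [Ring R] [Algebra k R]
    [FiniteDimensional k R] :
    RightDualKasch R ↔ LeftKasch R :=
  ⟨left_of_right k R, right_of_left k R⟩
end

section
/- Let R be a ring that is a right H-ring and a right max-ring. Then R is right strongly dual Kasch, i.e. for every simple right R-module S and every injective hull E of S there exists a surjective R-linear map E → S. -/
/-!
STATEMENT 10: If `R` is a right H-ring (any linear map between injective hulls of
non-isomorphic simple right modules is zero) and a right max-ring (every nonzero right
module has a maximal submodule), then `R` is right strongly dual Kasch: for every
simple right `R`-module `S` and every injective hull `E` of `S` there is a surjective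
linear map `E → S`. Right `R`-modules are formalized as `Rᵐᵒᵖ`-modules.
-/

universe u

/-- Every submodule of an injective module has an injective hull inside it. -/
theorem exists_hull_in_injective {A : Type u} [Ring A] {I : Type u} [AddCommGroup I] [Module A I]
    (hI : Module.Injective A I) (T : Submodule A I) :
    ∃ F : Submodule A I, T ≤ F ∧ (∀ x ∈ F, x ≠ 0 → ∃ a : A, a • x ∈ T ∧ a • x ≠ 0) ∧
      Module.Injective A F := by
  obtain ⟨F, hTF, hF⟩ := zorn_le_nonempty₀
    {F : Submodule A I | ∀ x ∈ F, x ≠ 0 → ∃ a : A, a • x ∈ T ∧ a • x ≠ 0}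
    (fun c hc hcc y hy => ⟨sSup c, fun x hx hx0 => by
      obtain ⟨p, hp, hxp⟩ := (Submodule.mem_sSup_of_directed ⟨y, hy⟩ hcc.directedOn).1 hx
      exact hc hp x hxp hx0, fun _ => le_sSup⟩) T
    (fun x hx hx0 => ⟨1, by simpa using hx, by simpa using hx0⟩)
  obtain ⟨C, -, hC⟩ := zorn_le_nonempty₀
    {C : Submodule A I | ∀ x ∈ C, x ∈ F → x = 0}
    (fun c hc hcc y hy => ⟨sSup c, fun x hx hxF => by
      obtain ⟨p, hp, hxp⟩ := (Submodule.mem_sSup_of_directed ⟨y, hy⟩ hcc.directedOn).1 hx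
      exact hc hp x hxp hxF, fun _ => le_sSup⟩) ⊥
    (fun x hx _ => by simpa using hx)
  have hinj : Function.Injective (C.mkQ ∘ₗ F.subtype) := by
    rw [injective_iff_map_eq_zero]
    intro x hx
    have hxC : (x : I) ∈ C := by simpa using hx
    exact Subtype.ext (hC.1 x hxC x.2)
  obtain ⟨h, hh⟩ := hI.out (C.mkQ ∘ₗ F.subtype) hinj F.subtype
  have hπ : ∀ x ∈ F, h (C.mkQ x) = x := fun x hx => hh ⟨x, hx⟩
  have hrange : LinearMap.range (h ∘ₗ C.mkQ) ≤ F := by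
    refine hF.2 ?_ (fun x hx => ⟨x, hπ x hx⟩)
    rintro _ ⟨z, rfl⟩ hy
    simp only [LinearMap.comp_apply] at hy ⊢
    have hzC : z ∉ C := fun hz => hy (by
      rw [Submodule.mkQ_apply, (Submodule.Quotient.mk_eq_zero C).2 hz, map_zero])
    have hnot : ¬ (∀ x ∈ C ⊔ Submodule.span A {z}, x ∈ F → x = 0) := fun H =>
      hzC (hC.2 H le_sup_left (Submodule.mem_sup_right (Submodule.mem_span_singleton_self z)))
    push Not at hnot
    obtain ⟨x, hx, hxF, hx0⟩ := hnot
    obtain ⟨c, hc, w, hw, rfl⟩ := Submodule.mem_sup.1 hx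
    obtain ⟨a, rfl⟩ := Submodule.mem_span_singleton.1 hw
    have e : a • h (C.mkQ z) = c + a • z := by
      rw [← hπ _ hxF, map_add, map_smul, map_add, map_smul, Submodule.mkQ_apply C c,
        (Submodule.Quotient.mk_eq_zero C).2 hc, map_zero, zero_add]
    obtain ⟨b, hb, hb0⟩ := hF.1 _ hxF hx0
    exact ⟨b * a, by rwa [mul_smul, e], by rwa [mul_smul, e]⟩
  refine ⟨F, hTF, hF.1, ⟨?_⟩⟩
  intro X Y _ _ _ _ f hf g
  obtain ⟨k, hk⟩ := hI.out f hf (F.subtype ∘ₗ g)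
  refine ⟨LinearMap.codRestrict F (h ∘ₗ C.mkQ ∘ₗ k) (fun y => hrange ⟨k y, rfl⟩), fun x => ?_⟩
  apply Subtype.ext
  simp only [LinearMap.codRestrict_apply, LinearMap.comp_apply, hk]
  exact hπ _ (g x).2

theorem exists_injective_hull {A : Type u} [Ring A] (T : Type u) [AddCommGroup T] [Module A T] :
    ∃ (E : Type u) (_ : AddCommGroup E) (_ : Module A E) (i : T →ₗ[A] E),
      Module.Injective A E ∧ Function.Injective i ∧
      ∀ K : Submodule A E, K ≠ ⊥ → K ⊓ LinearMap.range i ≠ ⊥ := by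
  have ei : CategoryTheory.EnoughInjectives (ModuleCat.{u} A) := inferInstance
  obtain ⟨I, inj, f, monof⟩ := ei.1 (ModuleCat.of A T)
  have hI : Module.Injective A I := (Module.injective_iff_injective_object A I).2 inj
  have hf : Function.Injective f.hom := (ModuleCat.mono_iff_injective f).1 monof
  obtain ⟨F, hTF, hess, hF⟩ := exists_hull_in_injective hI (LinearMap.range f.hom)
  refine ⟨F, inferInstance, inferInstance,
    LinearMap.codRestrict F f.hom (fun x => hTF ⟨x, rfl⟩), hF, ?_, ?_⟩
  · intro x y hxy
    exact hf (congrArg Subtype.val hxy)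
  · intro K hK
    obtain ⟨x, hx, hx0⟩ := Submodule.exists_mem_ne_zero_of_ne_bot hK
    obtain ⟨a, ⟨t, ht⟩, ha0⟩ := hess x x.2 (fun h => hx0 (Subtype.ext h))
    rw [Submodule.ne_bot_iff]
    refine ⟨a • x, ⟨K.smul_mem a hx, t, Subtype.ext ht⟩, fun h => ha0 ?_⟩
    exact congrArg Subtype.val h

theorem stronglyDualKasch_of_HRing_of_maxRing (R : Type u) [Ring R]
    -- `R` is a right H-ring:
    (hH : ∀ (S : Type u) [AddCommGroup S] [Module Rᵐᵒᵖ S]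
        (T : Type u) [AddCommGroup T] [Module Rᵐᵒᵖ T],
      IsSimpleModule Rᵐᵒᵖ S → IsSimpleModule Rᵐᵒᵖ T →
      ¬ Nonempty (S ≃ₗ[Rᵐᵒᵖ] T) →
      ∀ (ES : Type u) [AddCommGroup ES] [Module Rᵐᵒᵖ ES] (iS : S →ₗ[Rᵐᵒᵖ] ES),
        Module.Injective Rᵐᵒᵖ ES → Function.Injective iS →
        (∀ K : Submodule Rᵐᵒᵖ ES, K ≠ ⊥ → K ⊓ LinearMap.range iS ≠ ⊥) →
      ∀ (ET : Type u) [AddCommGroup ET] [Module Rᵐᵒᵖ ET] (iT : T →ₗ[Rᵐᵒᵖ] ET),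
        Module.Injective Rᵐᵒᵖ ET → Function.Injective iT →
        (∀ K : Submodule Rᵐᵒᵖ ET, K ≠ ⊥ → K ⊓ LinearMap.range iT ≠ ⊥) →
      ∀ f : ES →ₗ[Rᵐᵒᵖ] ET, f = 0)
    -- `R` is a right max-ring:
    (hmax : ∀ (M : Type u) [AddCommGroup M] [Module Rᵐᵒᵖ M], Nontrivial M →
      ∃ N : Submodule Rᵐᵒᵖ M, IsCoatom N) :
    -- `R` is right strongly dual Kasch:
    ∀ (S : Type u) [AddCommGroup S] [Module Rᵐᵒᵖ S], IsSimpleModule Rᵐᵒᵖ S →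
      ∀ (E : Type u) [AddCommGroup E] [Module Rᵐᵒᵖ E] (i : S →ₗ[Rᵐᵒᵖ] E),
        Module.Injective Rᵐᵒᵖ E → Function.Injective i →
        (∀ K : Submodule Rᵐᵒᵖ E, K ≠ ⊥ → K ⊓ LinearMap.range i ≠ ⊥) →
        ∃ f : E →ₗ[Rᵐᵒᵖ] S, Function.Surjective f := by
  intro S _ _ hS E _ _ i hE hi hess
  have hSn : Nontrivial S := IsSimpleModule.nontrivial Rᵐᵒᵖ S
  obtain ⟨N, hN⟩ := hmax E hi.nontrivial
  have hT : IsSimpleModule Rᵐᵒᵖ (E ⧸ N) := isSimpleModule_iff_isCoatom.2 hN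
  have hTn : Nontrivial (E ⧸ N) := IsSimpleModule.nontrivial Rᵐᵒᵖ _
  obtain ⟨ET, _, _, j, hET, hj, hjess⟩ := exists_injective_hull (A := Rᵐᵒᵖ) (E ⧸ N)
  by_cases hiso : Nonempty (S ≃ₗ[Rᵐᵒᵖ] (E ⧸ N))
  · obtain ⟨e⟩ := hiso
    exact ⟨e.symm.toLinearMap ∘ₗ N.mkQ, e.symm.surjective.comp N.mkQ_surjective⟩
  · exfalso
    have h0 := hH S (E ⧸ N) hS hT hiso E i hE hi hess ET j hET hj hjess (j ∘ₗ N.mkQ)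
    obtain ⟨t, ht⟩ := exists_ne (0 : E ⧸ N)
    obtain ⟨x, rfl⟩ := N.mkQ_surjective t
    exact ht (hj (by rw [map_zero]; exact LinearMap.congr_fun h0 x))
end

section
/- Let R be a right dual Kasch ring in which every right ideal of R is projective as a right R-module (i.e. R is right hereditary). Then every simple right R-module is injective, i.e. R is a right V-ring. -/
/-!
STATEMENT 11: A right dual Kasch ring that is right hereditary (every right ideal is
projective as a right module) is a right V-ring: every simple right `R`-module is
injective. Right `R`-modules are formalized as `Rᵐᵒᵖ`-modules, and right ideals of `R`
as `Rᵐᵒᵖ`-submodules of `R`.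
-/

universe u

/-- `R` and `Rᵐᵒᵖ` are isomorphic as right `R`-modules. -/
def opRightEquiv (R : Type u) [Ring R] : R ≃ₗ[Rᵐᵒᵖ] Rᵐᵒᵖ where
  toFun x := MulOpposite.op x
  invFun x := MulOpposite.unop x
  left_inv _ := rfl
  right_inv _ := rfl
  map_add' _ _ := rfl
  map_smul' _ _ := rfl

theorem vRing_of_rightDualKasch_of_rightHereditary
    (R : Type u) [Ring R] (hdk : RightDualKasch R)
    (hher : ∀ I : Submodule Rᵐᵒᵖ R, Module.Projective Rᵐᵒᵖ I) :
    ∀ (S : Type u) [AddCommGroup S] [Module Rᵐᵒᵖ S], IsSimpleModule Rᵐᵒᵖ S →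
      Module.Injective Rᵐᵒᵖ S := by
  intro S _ _ hS
  obtain ⟨Q, _, _, hQ, f, hf⟩ := hdk S hS
  apply Module.Baer.injective
  intro I g
  have hI : Module.Projective Rᵐᵒᵖ I := by
    have := hher (Submodule.map (opRightEquiv R).symm.toLinearMap I)
    exact Module.Projective.of_equiv ((opRightEquiv R).symm.submoduleMap I).symm
  obtain ⟨h, hh⟩ := Module.projective_lifting_property f g hf
  obtain ⟨k, hk⟩ := Module.Baer.of_injective hQ I h
  refine ⟨f ∘ₗ k, fun x hx => ?_⟩
  rw [LinearMap.comp_apply, hk x hx, ← hh, LinearMap.comp_apply]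
end

section
/- Let G be a finite group and let R be a ring in which the order of G is invertible. Then R is right dual Kasch if and only if the group ring R[G] (the monoid algebra of G over R) is right dual Kasch. -/
/-!
STATEMENT 12: Let `G` be a finite group and `R` a ring in which the order of `G` is
invertible. Then `R` is right dual Kasch if and only if the group ring `R[G]`
(the monoid algebra `MonoidAlgebra R G`) is right dual Kasch.
Right modules are formalized as modules over the opposite ring.
-/

universe u

/-- The inclusion of the coefficient ring, on opposite rings. -/
noncomputable def iA (R G : Type u) [Ring R] [Group G] : Rᵐᵒᵖ →+* (MonoidAlgebra R G)ᵐᵒᵖ :=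
  RingHom.op (MonoidAlgebra.singleOneRingHom (R := R) (M := G))

/-- The inclusion of the group elements in the opposite of the group ring. -/
noncomputable def jG (R : Type u) {G : Type u} [Ring R] [Group G] (g : G) :
    (MonoidAlgebra R G)ᵐᵒᵖ := MulOpposite.op (MonoidAlgebra.single g 1)

/-- Functions on `G` with values in `X`: the (co)induced module. -/
def CoInd (G X : Type u) : Type u := G → X

section
variable {R G : Type u} [Ring R] [Group G]

theorem iA_apply (a : Rᵐᵒᵖ) :
    iA R G a = MulOpposite.op (MonoidAlgebra.single 1 a.unop) := rfl

theorem jG_mul (g h : G) : jG R h * jG R g = jG R (g * h) := by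
  simp [jG, ← MulOpposite.op_mul, MonoidAlgebra.single_mul_single]

theorem jG_one : jG R (1 : G) = 1 := rfl

theorem iA_jG (a : Rᵐᵒᵖ) (g : G) :
    iA R G a * jG R g = MulOpposite.op (MonoidAlgebra.single g a.unop) := by
  simp [jG, iA_apply, ← MulOpposite.op_mul, MonoidAlgebra.single_mul_single]

theorem jG_iA (a : Rᵐᵒᵖ) (g : G) : jG R g * iA R G a = iA R G a * jG R g := by
  rw [iA_jG]
  simp [jG, iA_apply, ← MulOpposite.op_mul, MonoidAlgebra.single_mul_single]

theorem B_induction {p : (MonoidAlgebra R G)ᵐᵒᵖ → Prop} (b : (MonoidAlgebra R G)ᵐᵒᵖ)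
    (h0 : p 0) (hadd : ∀ x y, p x → p y → p (x + y))
    (hs : ∀ (a : Rᵐᵒᵖ) (g : G), p (iA R G a * jG R g)) : p b := by
  induction b using MulOpposite.rec' with
  | h b =>
    induction b using MonoidAlgebra.induction_linear with
    | zero => exact h0
    | add x y hx hy => exact hadd _ _ hx hy
    | single g r => simpa [iA_jG] using hs (MulOpposite.op r) g

/-- An additive map commuting with scalars and group elements is linear. -/
noncomputable def mkB {M N : Type u} [AddCommGroup M] [AddCommGroup N]
    [Module (MonoidAlgebra R G)ᵐᵒᵖ M] [Module (MonoidAlgebra R G)ᵐᵒᵖ N]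
    (f : M →+ N) (h1 : ∀ (a : Rᵐᵒᵖ) (m : M), f (iA R G a • m) = iA R G a • f m)
    (h2 : ∀ (g : G) (m : M), f (jG R g • m) = jG R g • f m) :
    M →ₗ[(MonoidAlgebra R G)ᵐᵒᵖ] N where
  toFun := f
  map_add' := f.map_add
  map_smul' b m := by
    simp only [RingHom.id_apply]
    induction b using B_induction with
    | h0 => simp
    | hadd x y hx hy => simp [add_smul, hx, hy]
    | hs a g => rw [mul_smul, mul_smul, h1, h2]

instance (X : Type u) [AddCommGroup X] : AddCommGroup (CoInd G X) :=
  inferInstanceAs (AddCommGroup (G → X))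

variable {X Y M : Type u} [AddCommGroup X] [Module Rᵐᵒᵖ X] [AddCommGroup Y] [Module Rᵐᵒᵖ Y]
  [AddCommGroup M] [Module Rᵐᵒᵖ M] [Module (MonoidAlgebra R G)ᵐᵒᵖ M]

instance : Module Rᵐᵒᵖ (CoInd G X) :=
  inferInstanceAs (Module Rᵐᵒᵖ (G → X))

/-- Translation action. -/
def transl (G X : Type u) [Group G] [AddCommGroup X] : Gᵐᵒᵖ →* AddMonoid.End (CoInd G X) where
  toFun g :=
    { toFun := fun f x => f (g.unop * x)
      map_zero' := rfl
      map_add' := fun _ _ => rfl }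
  map_one' := by ext f; funext x; exact congrArg f (one_mul x)
  map_mul' g h := by
    ext f; funext x
    exact congrArg f (mul_assoc _ _ _)

theorem transl_commute (R G X : Type u) [Ring R] [Group G] [AddCommGroup X] [Module Rᵐᵒᵖ X]
    (a : Rᵐᵒᵖ) (g : Gᵐᵒᵖ) :
    Commute (Module.toAddMonoidEnd Rᵐᵒᵖ (CoInd G X) a) (transl G X g) := rfl

/-- The structure map of the coinduced module. -/
noncomputable def actB (R G X : Type u) [Ring R] [Group G] [AddCommGroup X] [Module Rᵐᵒᵖ X] :
    (MonoidAlgebra R G)ᵐᵒᵖ →+* AddMonoid.End (CoInd G X) :=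
  (MonoidAlgebra.liftNCRingHom (Module.toAddMonoidEnd Rᵐᵒᵖ (CoInd G X)) (transl G X)
    (transl_commute R G X)).comp (MonoidAlgebra.opRingEquiv (R := R) (M := G)).toRingHom

noncomputable instance : Module (MonoidAlgebra R G)ᵐᵒᵖ (CoInd G X) :=
  Module.compHom _ (actB R G X)

theorem single_smul_coind (a : Rᵐᵒᵖ) (g : G) (f : CoInd G X) (x : G) :
    ((MulOpposite.op (MonoidAlgebra.single g a.unop) : (MonoidAlgebra R G)ᵐᵒᵖ) • f) x
      = a • f (g * x) := by
  change (actB R G X (MulOpposite.op (MonoidAlgebra.single g a.unop)) f) x = _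
  have : actB R G X (MulOpposite.op (MonoidAlgebra.single g a.unop)) =
      Module.toAddMonoidEnd Rᵐᵒᵖ (CoInd G X) a * transl G X (MulOpposite.op g) := by
    simp only [actB, RingHom.comp_apply]
    change MonoidAlgebra.liftNCRingHom _ _ _ (MonoidAlgebra.opRingEquiv _) = _
    rw [MonoidAlgebra.opRingEquiv_single, MonoidAlgebra.liftNCRingHom_single]
    rfl
  rw [this]
  rfl

theorem iA_smul_coind (a : Rᵐᵒᵖ) (f : CoInd G X) : iA R G a • f = a • f := by
  funext x
  rw [iA_apply, single_smul_coind, one_mul]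
  rfl

theorem jG_smul_coind (g : G) (f : CoInd G X) (x : G) : (jG R g • f) x = f (g * x) := by
  have := single_smul_coind (R := R) 1 g f x
  rwa [one_smul] at this

/-- Turn a group-ring-linear map into an `R`-linear one. -/
noncomputable def resA {N : Type u} [AddCommGroup N] [Module Rᵐᵒᵖ N] [Module (MonoidAlgebra R G)ᵐᵒᵖ N]
    (hM : ∀ (a : Rᵐᵒᵖ) (m : M), iA R G a • m = a • m)
    (hN : ∀ (a : Rᵐᵒᵖ) (m : N), iA R G a • m = a • m)
    (f : M →ₗ[(MonoidAlgebra R G)ᵐᵒᵖ] N) : M →ₗ[Rᵐᵒᵖ] N where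
  toFun := f
  map_add' := f.map_add
  map_smul' a m := by simp [← hM, ← hN]

/-- Coinduction universal property. -/
noncomputable def coind (hM : ∀ (a : Rᵐᵒᵖ) (m : M), iA R G a • m = a • m)
    (φ : M →ₗ[Rᵐᵒᵖ] X) : M →ₗ[(MonoidAlgebra R G)ᵐᵒᵖ] CoInd G X :=
  mkB { toFun := fun m x => φ (jG R x • m)
        map_zero' := by funext x; simp; rfl
        map_add' := fun m n => by funext x; simp; rfl }
    (fun a m => by
      rw [iA_smul_coind]
      funext x
      change φ (jG R x • iA R G a • m) = a • φ (jG R x • m)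
      rw [smul_smul, jG_iA, mul_smul, hM, map_smul])
    (fun g m => by
      funext x
      rw [jG_smul_coind]
      change φ (jG R x • jG R g • m) = φ (jG R (g * x) • m)
      rw [smul_smul, jG_mul])

theorem coind_apply (hM : ∀ (a : Rᵐᵒᵖ) (m : M), iA R G a • m = a • m)
    (φ : M →ₗ[Rᵐᵒᵖ] X) (m : M) (x : G) : coind hM φ m x = φ (jG R x • m) := rfl

/-- Evaluation at a group element. -/
def ev (x : G) : CoInd G X →ₗ[Rᵐᵒᵖ] X where
  toFun f := f x
  map_add' _ _ := rfl
  map_smul' _ _ := rfl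

/-- Functoriality. -/
noncomputable def mapC (φ : X →ₗ[Rᵐᵒᵖ] Y) : CoInd G X →ₗ[(MonoidAlgebra R G)ᵐᵒᵖ] CoInd G Y :=
  coind iA_smul_coind (φ ∘ₗ ev 1)

theorem mapC_apply (φ : X →ₗ[Rᵐᵒᵖ] Y) (f : CoInd G X) (x : G) : mapC φ f x = φ (f x) := by
  change φ ((jG R x • f) 1) = _
  rw [jG_smul_coind, mul_one]

open Classical in
/-- Functions supported at one. -/
noncomputable def dl (G : Type u) [Group G] : X →ₗ[Rᵐᵒᵖ] CoInd G X :=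
  LinearMap.single Rᵐᵒᵖ (fun _ : G => X) 1

theorem dl_one (x : X) : dl (R := R) G x 1 = x := by
  classical exact Pi.single_eq_same (M := fun _ : G => X) 1 x

theorem dl_ne (x : X) (g : G) (hg : g ≠ 1) : dl (R := R) G x g = 0 := by
  classical exact Pi.single_eq_of_ne (M := fun _ : G => X) hg x

variable [Fintype G]

/-- Induction universal property. -/
noncomputable def ind (hM : ∀ (a : Rᵐᵒᵖ) (m : M), iA R G a • m = a • m)
    (ψ : X →ₗ[Rᵐᵒᵖ] M) : CoInd G X →ₗ[(MonoidAlgebra R G)ᵐᵒᵖ] M :=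
  mkB { toFun := fun f => ∑ x : G, jG R x⁻¹ • ψ (f x)
        map_zero' := Finset.sum_eq_zero fun x _ => by
          change jG R x⁻¹ • ψ 0 = 0
          simp
        map_add' := fun f g => by
          rw [← Finset.sum_add_distrib]
          refine Finset.sum_congr rfl fun x _ => ?_
          change jG R x⁻¹ • ψ (f x + g x) = _
          simp }
    (fun a f => by
      rw [iA_smul_coind]
      change ∑ x : G, jG R x⁻¹ • ψ (a • f x) = iA R G a • ∑ x : G, jG R x⁻¹ • ψ (f x)
      rw [Finset.smul_sum]
      refine Finset.sum_congr rfl fun x _ => ?_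
      rw [map_smul, ← hM, smul_smul, jG_iA, mul_smul])
    (fun g f => by
      change ∑ x : G, jG R x⁻¹ • ψ ((jG R g • f) x) = jG R g • ∑ x : G, jG R x⁻¹ • ψ (f x)
      rw [Finset.smul_sum, ← Equiv.sum_comp (Equiv.mulLeft g)
        (fun x => jG R g • jG R x⁻¹ • ψ (f x))]
      refine Finset.sum_congr rfl fun x _ => ?_
      rw [jG_smul_coind, smul_smul, jG_mul]
      simp)

theorem ind_apply (hM : ∀ (a : Rᵐᵒᵖ) (m : M), iA R G a • m = a • m)
    (ψ : X →ₗ[Rᵐᵒᵖ] M) (f : CoInd G X) : ind hM ψ f = ∑ x : G, jG R x⁻¹ • ψ (f x) := rfl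

theorem ind_dl (hM : ∀ (a : Rᵐᵒᵖ) (m : M), iA R G a • m = a • m)
    (ψ : X →ₗ[Rᵐᵒᵖ] M) (x : X) : ind hM ψ (dl (R := R) G x) = ψ x := by
  rw [ind_apply, Finset.sum_eq_single 1]
  · rw [dl_one, inv_one, jG_one, one_smul]
  · intro g _ hg
    rw [dl_ne _ _ hg]; simp
  · simp

theorem coInd_eq_sum (f : CoInd G X) :
    f = ∑ x : G, jG R x⁻¹ • dl (R := R) G (f x) := by
  have key : ∀ y : G, f y = ∑ x : G, (jG R x⁻¹ • dl (R := R) G (f x)) y := by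
    intro y
    rw [Finset.sum_eq_single y]
    · rw [jG_smul_coind, inv_mul_cancel, dl_one]
    · intro x _ hx
      rw [jG_smul_coind, dl_ne]
      intro h
      exact hx (inv_mul_eq_one.mp h)
    · simp
  funext y
  rw [key y]
  exact (Finset.sum_apply (M := fun _ : G => X) y Finset.univ
    (fun x => jG R x⁻¹ • dl (R := R) G (f x))).symm

/-- Coinduced modules of injective modules are injective. -/
theorem injective_coInd (hX : Module.Injective Rᵐᵒᵖ X) :
    Module.Injective (MonoidAlgebra R G)ᵐᵒᵖ (CoInd G X) := by
  refine ⟨fun U V _ _ _ _ f hf g => ?_⟩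
  let _ := Module.compHom U (iA R G)
  let _ := Module.compHom V (iA R G)
  have hU : ∀ (a : Rᵐᵒᵖ) (m : U), iA R G a • m = a • m := fun _ _ => rfl
  have hV : ∀ (a : Rᵐᵒᵖ) (m : V), iA R G a • m = a • m := fun _ _ => rfl
  obtain ⟨φ, hφ⟩ := hX.out (resA hU hV f) hf (ev 1 ∘ₗ resA hU iA_smul_coind g)
  refine ⟨coind hV φ, fun u => ?_⟩
  funext x
  rw [coind_apply, ← map_smul]
  refine (hφ _).trans ?_
  change g (jG R x • u) 1 = _
  rw [map_smul, jG_smul_coind, mul_one]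

/-- Restrictions of injective modules are injective. -/
theorem injective_res (hM : ∀ (a : Rᵐᵒᵖ) (m : M), iA R G a • m = a • m)
    (hI : Module.Injective (MonoidAlgebra R G)ᵐᵒᵖ M) : Module.Injective Rᵐᵒᵖ M := by
  refine ⟨fun U V _ _ _ _ f hf g => ?_⟩
  obtain ⟨φ, hφ⟩ := hI.out (mapC (G := G) f) (fun u v huv => by
    funext x
    apply hf
    rw [← mapC_apply, ← mapC_apply, huv]) (ind hM g)
  refine ⟨resA iA_smul_coind hM φ ∘ₗ dl G, fun u => ?_⟩
  change φ (dl G (f u)) = g u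
  rw [← ind_dl hM g, ← hφ]
  congr 1
  funext x
  rw [mapC_apply]
  by_cases hx : x = 1
  · subst hx; rw [dl_one, dl_one]
  · rw [dl_ne _ _ hx, dl_ne _ _ hx, map_zero]

theorem exists_simple_quotient {A N : Type u} [Ring A] [AddCommGroup N] [Module A N]
    [Module.Finite A N] [Nontrivial N] : ∃ m : Submodule A N, IsSimpleModule A (N ⧸ m) := by
  obtain ⟨m, hm, -⟩ := (eq_top_or_exists_le_coatom (⊥ : Submodule A N)).resolve_left bot_ne_top
  exact ⟨m, isSimpleModule_iff_isCoatom.mpr hm⟩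

theorem exists_simple_image {A N : Type u} [Ring A] [AddCommGroup N] [Module A N]
    [Module.Finite A N] [Nontrivial N] :
    ∃ (T : Type u) (_ : AddCommGroup T) (_ : Module A T), IsSimpleModule A T ∧
      ∃ f : N →ₗ[A] T, Function.Surjective f := by
  obtain ⟨m, hm⟩ := exists_simple_quotient (A := A) (N := N)
  exact ⟨N ⧸ m, inferInstance, inferInstance, hm, m.mkQ, m.mkQ_surjective⟩

theorem forward (H : RightDualKasch R) : RightDualKasch (MonoidAlgebra R G) := by
  intro S _ _ hS
  let _ := Module.compHom S (iA R G)
  have hc : ∀ (a : Rᵐᵒᵖ) (m : S), iA R G a • m = a • m := fun _ _ => rfl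
  have : Nontrivial S := IsSimpleModule.nontrivial (MonoidAlgebra R G)ᵐᵒᵖ S
  obtain ⟨s, hs⟩ := exists_ne (0 : S)
  have : Module.Finite Rᵐᵒᵖ S := by
    have h1 : ind (G := G) hc (LinearMap.toSpanSingleton Rᵐᵒᵖ S s) ≠ 0 := by
      intro h
      apply hs
      have := ind_dl (G := G) hc (LinearMap.toSpanSingleton Rᵐᵒᵖ S s) 1
      rw [h] at this
      simpa using this.symm
    have : Module.Finite Rᵐᵒᵖ (CoInd G Rᵐᵒᵖ) :=
      inferInstanceAs (Module.Finite Rᵐᵒᵖ (G → Rᵐᵒᵖ))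
    have h2 := LinearMap.surjective_of_ne_zero h1
    exact Module.Finite.of_surjective (resA iA_smul_coind hc (ind (G := G) hc
      (LinearMap.toSpanSingleton Rᵐᵒᵖ S s)))
      h2
  obtain ⟨m, hm⟩ := exists_simple_quotient (A := Rᵐᵒᵖ) (N := S)
  obtain ⟨Q, _, _, hQ, q, hq⟩ := H (S ⧸ m) hm
  have hne : coind (G := G) hc m.mkQ ≠ 0 := by
    intro h
    have : Nontrivial (S ⧸ m) := IsSimpleModule.nontrivial Rᵐᵒᵖ _
    obtain ⟨t, ht⟩ := exists_ne (0 : S ⧸ m)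
    obtain ⟨t, rfl⟩ := m.mkQ_surjective t
    apply ht
    have := coind_apply (G := G) hc m.mkQ t 1
    rw [jG_one, one_smul, h] at this
    exact this.symm
  have : IsSemisimpleModule Rᵐᵒᵖ (CoInd G (S ⧸ m)) :=
    inferInstanceAs (IsSemisimpleModule Rᵐᵒᵖ (G → (S ⧸ m)))
  have hinj := LinearMap.injective_of_ne_zero hne
  obtain ⟨ρ, hρ⟩ := IsSemisimpleModule.extension_property
    (resA hc iA_smul_coind (coind (G := G) hc m.mkQ))
    hinj LinearMap.id
  have hP : Module.Injective Rᵐᵒᵖ (CoInd G Q) :=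
    injective_res iA_smul_coind (injective_coInd hQ)
  let p : CoInd G Q →ₗ[Rᵐᵒᵖ] S := ρ ∘ₗ resA iA_smul_coind iA_smul_coind (mapC (G := G) q)
  refine ⟨CoInd G (CoInd G Q), inferInstance, inferInstance, injective_coInd hP, ind hc p, ?_⟩
  intro t
  let v : CoInd G (S ⧸ m) := coind (G := G) hc m.mkQ t
  choose w hw using fun x : G => hq (v x)
  refine ⟨dl (R := R) G (w : CoInd G Q), (ind_dl hc p _).trans ?_⟩
  change ρ (mapC q (w : CoInd G Q)) = t
  have : mapC q (w : CoInd G Q) = v := by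
    funext x
    exact (mapC_apply q _ x).trans (hw x)
  rw [this]
  exact LinearMap.congr_fun hρ t

theorem backward (H : RightDualKasch (MonoidAlgebra R G)) : RightDualKasch R := by
  intro S _ _ hS
  have : Nontrivial S := IsSimpleModule.nontrivial Rᵐᵒᵖ S
  obtain ⟨s, hs⟩ := exists_ne (0 : S)
  have : Nontrivial (CoInd G S) := inferInstanceAs (Nontrivial (G → S))
  have : Module.Finite (MonoidAlgebra R G)ᵐᵒᵖ (CoInd G S) := by
    refine ⟨⟨{dl (R := R) G s}, ?_⟩⟩
    rw [Finset.coe_singleton, eq_top_iff]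
    intro f _
    rw [coInd_eq_sum (R := R) f]
    refine Submodule.sum_mem _ fun x _ => Submodule.smul_mem _ _ ?_
    obtain ⟨a, ha⟩ := IsSimpleModule.toSpanSingleton_surjective Rᵐᵒᵖ hs (f x)
    rw [← ha, LinearMap.toSpanSingleton_apply, map_smul, ← iA_smul_coind]
    exact Submodule.smul_mem _ _ (Submodule.mem_span_singleton_self _)
  obtain ⟨T, _, _, hT, mk, hmk⟩ := exists_simple_image (A := (MonoidAlgebra R G)ᵐᵒᵖ)
    (N := CoInd G S)
  obtain ⟨Q, _, _, hQ, q, hq⟩ := H T hT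
  let _ := Module.compHom T (iA R G)
  let _ := Module.compHom Q (iA R G)
  have hcT : ∀ (a : Rᵐᵒᵖ) (m : T), iA R G a • m = a • m := fun _ _ => rfl
  have hcQ : ∀ (a : Rᵐᵒᵖ) (m : Q), iA R G a • m = a • m := fun _ _ => rfl
  have : Nontrivial T := IsSimpleModule.nontrivial (MonoidAlgebra R G)ᵐᵒᵖ T
  have : IsSemisimpleModule Rᵐᵒᵖ (CoInd G S) :=
    inferInstanceAs (IsSemisimpleModule Rᵐᵒᵖ (G → S))
  obtain ⟨σ, hσ⟩ := IsSemisimpleModule.lifting_property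
    (resA iA_smul_coind hcT mk) hmk LinearMap.id
  obtain ⟨t, ht⟩ := exists_ne (0 : T)
  have hne : ∃ x : G, σ t x ≠ 0 := by
    by_contra hcon
    push Not at hcon
    apply ht
    have h0 : σ t = 0 := by
      funext x
      exact hcon x
    have h1 := LinearMap.congr_fun hσ t
    rw [LinearMap.comp_apply, h0, map_zero] at h1
    exact h1.symm
  obtain ⟨x, hx⟩ := hne
  have hsurj : Function.Surjective (ev x ∘ₗ σ) :=
    LinearMap.surjective_of_ne_zero fun h => hx (LinearMap.congr_fun h t)
  exact ⟨Q, inferInstance, inferInstance, injective_res hcQ hQ,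
    (ev x ∘ₗ σ) ∘ₗ resA hcQ hcT q, hsurj.comp hq⟩
end

theorem rightDualKasch_iff_groupRing_rightDualKasch
    (R : Type u) [Ring R] (G : Type u) [Group G] [Fintype G]
    (h : IsUnit ((Fintype.card G : R))) :
    RightDualKasch R ↔ RightDualKasch (MonoidAlgebra R G) :=
  ⟨forward, backward⟩
end

section
/- Let R be a ring and let E be an injective hull of R as a right R-module. Then R is injective as a right R-module (i.e. R is right self-injective) if and only if R is right dual Kasch and E is a projective right R-module. -/
/-!
STATEMENT 14: Let `R` be a ring and `E` an injective hull of `R` as a right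
`R`-module. Then `R` is right self-injective if and only if `R` is right dual Kasch
and `E` is a projective right `R`-module.
Right `R`-modules are formalized as `Rᵐᵒᵖ`-modules.
-/

universe u

universe v

theorem injective_of_retract {A : Type v} [Ring A] {M N : Type v} [AddCommGroup M] [Module A M]
    [AddCommGroup N] [Module A N] (hM : Module.Injective A M) (s : N →ₗ[A] M) (p : M →ₗ[A] N)
    (h : ∀ x, p (s x) = x) : Module.Injective A N where
  out X Y _ _ _ _ f hf g := by
    obtain ⟨k, hk⟩ := hM.out f hf (s ∘ₗ g)
    exact ⟨p ∘ₗ k, fun x => by simp [hk, h]⟩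

/-- Right multiplication view: `R` and `Rᵐᵒᵖ` are isomorphic as `Rᵐᵒᵖ`-modules. -/
def opSelfEquiv (R : Type v) [Ring R] : R ≃ₗ[Rᵐᵒᵖ] Rᵐᵒᵖ where
  toFun := MulOpposite.op
  invFun := MulOpposite.unop
  map_add' _ _ := rfl
  map_smul' _ _ := rfl
  left_inv _ := rfl
  right_inv _ := rfl

/-- A projective module mapping nontrivially to every simple cyclic module has full trace. -/
theorem trace_eq_top {A : Type v} [Ring A] {E : Type v} [AddCommGroup E] [Module A E]
    [Module.Projective A E]
    (h : ∀ m : Ideal A, m.IsMaximal → ∃ f : E →ₗ[A] (A ⧸ m), f ≠ 0) :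
    (⨆ f : E →ₗ[A] A, LinearMap.range f) = ⊤ := by
  by_contra hne
  obtain ⟨m, hm, hle⟩ := Ideal.exists_le_maximal _ hne
  obtain ⟨f, hf⟩ := h m hm
  obtain ⟨g, hg⟩ := Module.projective_lifting_property (Submodule.mkQ m) f
    (Submodule.mkQ_surjective m)
  apply hf
  ext x
  rw [← hg]
  have : g x ∈ m := hle (Submodule.mem_iSup_of_mem g ⟨x, rfl⟩)
  simpa using this

theorem injective_of_trace {A : Type v} [Ring A] {E : Type v} [AddCommGroup E] [Module A E]
    (hE : Module.Injective A E)
    (h : (⨆ f : E →ₗ[A] A, LinearMap.range f) = ⊤) : Module.Injective A A := by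
  classical
  have h1 : (1 : A) ∈ (⨆ f : E →ₗ[A] A, LinearMap.range f) := h ▸ Submodule.mem_top
  obtain ⟨c, hc, hsum⟩ := (Submodule.mem_iSup_iff_exists_finsupp _ _).mp h1
  choose e he using hc
  let p : (c.support → E) →ₗ[A] A :=
    ∑ k : c.support, k.1 ∘ₗ LinearMap.proj k
  let x : c.support → E := fun k => e k.1
  have hp : p x = 1 := by
    simp only [p, x, LinearMap.sum_apply, LinearMap.comp_apply, LinearMap.proj_apply, he]
    rw [← hsum, Finsupp.sum]
    exact Finset.sum_coe_sort c.support (fun k => c k)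
  refine injective_of_retract (M := c.support → E) inferInstance
    (LinearMap.toSpanSingleton A _ x) p fun a => ?_
  rw [LinearMap.toSpanSingleton_apply, map_smul, hp, smul_eq_mul, mul_one]

theorem selfInjective_iff_rightDualKasch_and_hull_projective
    (R : Type u) [Ring R] (E : Type u) [AddCommGroup E] [Module Rᵐᵒᵖ E]
    (hE : Module.Injective Rᵐᵒᵖ E) (i : R →ₗ[Rᵐᵒᵖ] E) (hi : Function.Injective i)
    (hess : ∀ K : Submodule Rᵐᵒᵖ E, K ≠ ⊥ → K ⊓ LinearMap.range i ≠ ⊥) :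
    Module.Injective Rᵐᵒᵖ R ↔ (RightDualKasch R ∧ Module.Projective Rᵐᵒᵖ E) := by
  constructor
  · intro hR
    refine ⟨?_, ?_⟩
    · intro S _ _ hS
      have := IsSimpleModule.nontrivial Rᵐᵒᵖ S
      obtain ⟨x, hx⟩ := exists_ne (0 : S)
      exact ⟨R, inferInstance, inferInstance, hR,
        LinearMap.toSpanSingleton Rᵐᵒᵖ S x ∘ₗ (opSelfEquiv R).toLinearMap,
        (IsSimpleModule.toSpanSingleton_surjective Rᵐᵒᵖ hx).comp (opSelfEquiv R).surjective⟩
    · obtain ⟨p, hp⟩ := hR.out i hi LinearMap.id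
      have hker : LinearMap.ker p = ⊥ := by
        by_contra hne
        apply hess _ hne
        rw [eq_bot_iff]
        rintro y ⟨hy, ⟨r, rfl⟩⟩
        have h0 : p (i r) = 0 := hy
        rw [hp] at h0
        have h0' : r = 0 := h0
        simp [h0']
      have hbij : Function.Bijective p :=
        ⟨LinearMap.ker_eq_bot.mp hker, fun r => ⟨i r, hp r⟩⟩
      exact Module.Projective.of_equiv
        ((LinearEquiv.ofBijective p hbij).trans (opSelfEquiv R)).symm
  · rintro ⟨hK, hP⟩
    have hA : Module.Injective Rᵐᵒᵖ Rᵐᵒᵖ := by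
      refine injective_of_trace hE (trace_eq_top fun m hm => ?_)
      have hS : IsSimpleModule Rᵐᵒᵖ (Rᵐᵒᵖ ⧸ m) := isSimpleModule_iff_isCoatom.mpr hm.out
      have := IsSimpleModule.nontrivial Rᵐᵒᵖ (Rᵐᵒᵖ ⧸ m)
      obtain ⟨y, hy⟩ := exists_ne (0 : Rᵐᵒᵖ ⧸ m)
      obtain ⟨Q, _, _, hQ, q, hq⟩ := hK (Rᵐᵒᵖ ⧸ m) hS
      obtain ⟨x, rfl⟩ := hq y
      obtain ⟨k, hk⟩ := hQ.out i hi
        (LinearMap.toSpanSingleton Rᵐᵒᵖ Q x ∘ₗ (opSelfEquiv R).toLinearMap)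
      refine ⟨q ∘ₗ k, fun h0 => hy ?_⟩
      have h1 := LinearMap.congr_fun h0 (i 1)
      have h2 : k (i 1) = x := by
        rw [hk]
        exact one_smul Rᵐᵒᵖ x
      rwa [LinearMap.comp_apply, h2] at h1
    exact injective_of_retract hA (opSelfEquiv R).toLinearMap (opSelfEquiv R).symm.toLinearMap
      fun x => rfl
end

section
/- Let R be a right Noetherian, right dual Kasch ring such that some injective hull E of R as a right R-module is projective. Then R is injective as a right R-module (hence R is quasi-Frobenius). -/
/-!
STATEMENT 15: Let `R` be a right Noetherian, right dual Kasch ring such that some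
injective hull `E` of `R` as right `R`-module is projective. Then `R` is injective as
a right `R`-module (hence quasi-Frobenius).
Right `R`-modules are formalized as `Rᵐᵒᵖ`-modules; right Noetherian means `R` is
Noetherian as a right module over itself.
-/

universe u

theorem selfInjective_of_noetherian_rightDualKasch_hull_projective
    (R : Type u) [Ring R] [IsNoetherian Rᵐᵒᵖ R]
    (hdk : RightDualKasch R)
    (E : Type u) [AddCommGroup E] [Module Rᵐᵒᵖ E]
    (hE : Module.Injective Rᵐᵒᵖ E) (i : R →ₗ[Rᵐᵒᵖ] E) (hi : Function.Injective i)
    (hess : ∀ K : Submodule Rᵐᵒᵖ E, K ≠ ⊥ → K ⊓ LinearMap.range i ≠ ⊥)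
    (hproj : Module.Projective Rᵐᵒᵖ E) :
    Module.Injective Rᵐᵒᵖ R := by
  have ext : ∀ (X Y Q : Type u) [AddCommGroup X] [AddCommGroup Y] [AddCommGroup Q]
      [Module Rᵐᵒᵖ X] [Module Rᵐᵒᵖ Y] [Module Rᵐᵒᵖ Q], Module.Injective Rᵐᵒᵖ Q →
      ∀ (j : X →ₗ[Rᵐᵒᵖ] Y), Function.Injective j → ∀ g : X →ₗ[Rᵐᵒᵖ] Q,
      ∃ h : Y →ₗ[Rᵐᵒᵖ] Q, ∀ x, h (j x) = g x :=
    fun X Y Q _ _ _ _ _ _ hQ j hj g => hQ.out j hj g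
  -- the trace of `E` in `R` is everything
  have htr : (⨆ f : E →ₗ[Rᵐᵒᵖ] R, LinearMap.range f) = ⊤ := by
    by_contra hne
    obtain ⟨M, hM, hle⟩ := (eq_top_or_exists_le_coatom
      (⨆ f : E →ₗ[Rᵐᵒᵖ] R, LinearMap.range f)).resolve_left hne
    have hS : IsSimpleModule Rᵐᵒᵖ (R ⧸ M) := isSimpleModule_iff_isCoatom.2 hM
    obtain ⟨Q, _, _, hQ, p, hp⟩ := hdk (R ⧸ M) hS
    obtain ⟨q, hq⟩ := hp (M.mkQ 1)
    let c : R →ₗ[Rᵐᵒᵖ] Q :=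
      { toFun := fun r => MulOpposite.op r • q
        map_add' := fun a b => by rw [MulOpposite.op_add, add_smul]
        map_smul' := fun a b => by
          rw [RingHom.id_apply, smul_smul]; rfl }
    obtain ⟨h, hh⟩ := ext R E Q hQ i hi c
    obtain ⟨k, hk⟩ := Module.projective_lifting_property M.mkQ (p.comp h) M.mkQ_surjective
    have h1 : M.mkQ (k (i 1)) = M.mkQ 1 := by
      have := LinearMap.congr_fun hk (i 1)
      simp only [LinearMap.comp_apply] at this
      rw [this, hh, ← hq]
      simp [c]
    have h2 : k (i 1) ∈ M := hle (Submodule.mem_iSup_of_mem k ⟨i 1, rfl⟩)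
    have h3 : (1 : R) ∈ M := by
      rw [← Submodule.Quotient.mk_eq_zero]
      rw [Submodule.mkQ_apply, Submodule.mkQ_apply, (Submodule.Quotient.mk_eq_zero M).2 h2] at h1
      exact h1.symm
    apply hM.1
    rw [eq_top_iff]
    intro r _
    have := M.smul_mem (MulOpposite.op r) h3
    simpa using this
  refine ⟨fun X Y _ _ _ _ j hj g => ?_⟩
  have key : ∀ t ∈ (⨆ f : E →ₗ[Rᵐᵒᵖ] R, LinearMap.range f),
      ∃ h : Y →ₗ[Rᵐᵒᵖ] R, ∀ x, h (j x) = t * g x := by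
    intro t ht
    induction ht using Submodule.iSup_induction' with
    | mem f t ht =>
      obtain ⟨e, rfl⟩ := ht
      let c : R →ₗ[Rᵐᵒᵖ] E :=
        { toFun := fun r => MulOpposite.op r • e
          map_add' := fun a b => by rw [MulOpposite.op_add, add_smul]
          map_smul' := fun a b => by
            rw [RingHom.id_apply, smul_smul]; rfl }
      obtain ⟨h, hh⟩ := ext X Y E hE j hj (c.comp g)
      refine ⟨f.comp h, fun x => ?_⟩
      rw [LinearMap.comp_apply, hh]
      simp [c]
    | zero => exact ⟨0, fun x => by simp⟩
    | add a b _ _ ha hb =>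
      obtain ⟨h, hh⟩ := ha
      obtain ⟨k, hk⟩ := hb
      exact ⟨h + k, fun x => by rw [LinearMap.add_apply, hh, hk, add_mul]⟩
  obtain ⟨h, hh⟩ := key 1 (htr ▸ Submodule.mem_top)
  exact ⟨h, fun x => by rw [hh, one_mul]⟩
end

section
/- Let R be a commutative ring, let V be a minimal ideal of R (i.e. V is simple as an R-module), and let E be an injective hull of V. Then there exists a surjective R-linear map E → V. -/
/-!
STATEMENT 16: Let `R` be a commutative ring, `V` a minimal ideal of `R` (an ideal that
is simple as an `R`-module) and `E` an injective hull of `V`. Then there is a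
surjective `R`-linear map `E → V`.
-/

universe u

theorem minimal_ideal_image_of_injective_hull
    (R : Type u) [CommRing R] (V : Ideal R) (hV : IsSimpleModule R V)
    (E : Type u) [AddCommGroup E] [Module R E]
    (hE : Module.Injective R E) (i : V →ₗ[R] E) (hi : Function.Injective i)
    (hess : ∀ K : Submodule R E, K ≠ ⊥ → K ⊓ LinearMap.range i ≠ ⊥) :
    ∃ f : E →ₗ[R] V, Function.Surjective f := by
  haveI : Nontrivial V := IsSimpleModule.nontrivial R V
  obtain ⟨v, hv⟩ := exists_ne (0 : V)
  obtain ⟨g, hg⟩ := hE.out V.subtype (Submodule.injective_subtype V) i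
  have key : ∀ x : E, (LinearMap.lsmul R E (v : R)) x ∈ LinearMap.range i := by
    intro x
    rw [LinearMap.lsmul_apply]
    by_cases h0 : (v : R) • x = 0
    · rw [h0]; exact Submodule.zero_mem _
    have h1 := hess (Submodule.span R {(v : R) • x}) (by simpa using h0)
    obtain ⟨y, hy, hy0⟩ := (Submodule.ne_bot_iff _).1 h1
    obtain ⟨hy1, hy2⟩ := Submodule.mem_inf.1 hy
    obtain ⟨r, rfl⟩ := Submodule.mem_span_singleton.1 hy1
    have hrv : r • v ≠ 0 := by
      intro h
      apply hy0
      have h' : r * (v : R) = 0 := by simpa using congrArg Subtype.val h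
      rw [smul_smul, h', zero_smul]
    obtain ⟨s, hs⟩ := IsSimpleModule.toSpanSingleton_surjective R hrv v
    have hs' : s * (r * (v : R)) = v := by simpa using congrArg Subtype.val hs
    have := Submodule.smul_mem (LinearMap.range i) s hy2
    rwa [smul_smul, smul_smul, mul_assoc, hs'] at this
  let e := LinearEquiv.ofInjective i hi
  let f : E →ₗ[R] V := e.symm.toLinearMap.comp
    ((LinearMap.lsmul R E (v : R)).codRestrict (LinearMap.range i) key)
  have hf : f (g 1) = v := by
    apply e.injective
    apply Subtype.ext
    have h2 : (v : R) • g 1 = i v := by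
      rw [← hg v, ← map_smul]; simp
    simpa [f, e] using h2
  refine ⟨f, fun w => ?_⟩
  obtain ⟨t, ht⟩ := IsSimpleModule.toSpanSingleton_surjective R hv w
  refine ⟨t • g 1, ?_⟩
  rw [map_smul, hf]
  simpa using ht
end

section
/- Let R be a commutative Kasch ring, i.e. every simple R-module is isomorphic to a submodule of R. Then R is strongly dual Kasch: for every simple R-module S and every injective hull E of S there exists a surjective R-linear map E → S. -/
/-!
STATEMENT 17: Every commutative Kasch ring (every simple `R`-module embeds into `R`)
is strongly dual Kasch: for every simple `R`-module `S` and every injective hull `E`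
of `S` there is a surjective `R`-linear map `E → S`.
-/

universe u

theorem stronglyDualKasch_of_commutative_kasch
    (R : Type u) [CommRing R]
    (hkasch : ∀ (S : Type u) [AddCommGroup S] [Module R S], IsSimpleModule R S →
      ∃ f : S →ₗ[R] R, Function.Injective f) :
    ∀ (S : Type u) [AddCommGroup S] [Module R S], IsSimpleModule R S →
      ∀ (E : Type u) [AddCommGroup E] [Module R E] (i : S →ₗ[R] E),
        Module.Injective R E → Function.Injective i →
        (∀ K : Submodule R E, K ≠ ⊥ → K ⊓ LinearMap.range i ≠ ⊥) →
        ∃ f : E →ₗ[R] S, Function.Surjective f := by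
  intro S _ _ hS E _ _ i hE hi hess
  obtain ⟨f, hf⟩ := hkasch S hS
  have := hS
  have := IsSimpleModule.nontrivial R S
  obtain ⟨s, hs⟩ := exists_ne (0 : S)
  have gen : ∀ x : S, x ≠ 0 → ∀ y : S, ∃ q : R, q • x = y := fun x hx y => by
    obtain ⟨q, hq⟩ := IsSimpleModule.toSpanSingleton_surjective R hx y
    exact ⟨q, by simpa using hq⟩
  obtain ⟨g, hg⟩ := hE.out f hf i
  have hge : f s • g 1 = i s := by
    rw [← map_smul, smul_eq_mul, mul_one, hg]
  -- multiplication by `f s` maps `E` into the copy of `S`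
  have key : ∀ x : E, f s • x ∈ LinearMap.range i := by
    intro x
    by_cases h0 : f s • x = 0
    · rw [h0]; exact Submodule.zero_mem _
    have hK : Submodule.span R {f s • x} ≠ ⊥ := by
      simpa [Submodule.span_singleton_eq_bot] using h0
    obtain ⟨y, hy, hy0⟩ := Submodule.exists_mem_ne_zero_of_ne_bot (hess _ hK)
    obtain ⟨hy1, hy2⟩ := Submodule.mem_inf.1 hy
    obtain ⟨r, rfl⟩ := Submodule.mem_span_singleton.1 hy1
    have hrs : r • s ≠ 0 := by
      intro h
      apply hy0
      rw [smul_smul, ← smul_eq_mul, ← map_smul, h, map_zero, zero_smul]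
    obtain ⟨q, hq⟩ := gen _ hrs s
    have : f s • x = q • r • f s • x := by
      conv_lhs => rw [← hq]
      rw [map_smul, map_smul, smul_assoc, smul_assoc]
    rw [this]
    exact Submodule.smul_mem _ q hy2
  refine ⟨(LinearEquiv.ofInjective i hi).symm.toLinearMap ∘ₗ
    (LinearMap.codRestrict (LinearMap.range i) (LinearMap.lsmul R E (f s)) key), ?_⟩
  intro t
  obtain ⟨q, rfl⟩ := gen s hs t
  refine ⟨q • g 1, ?_⟩
  rw [LinearMap.comp_apply, LinearEquiv.coe_coe, LinearEquiv.symm_apply_eq]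
  apply Subtype.ext
  change f s • q • g 1 = i (q • s)
  rw [smul_comm, hge, map_smul]
end

section
/- Let R be a reversible ring (for all a, b ∈ R, ab = 0 implies ba = 0) that is right Kasch. Then R is classical: every element of R is either a zero divisor or invertible. -/
/-!
STATEMENT 18: A reversible ring (`a * b = 0` implies `b * a = 0`) that is right Kasch
(every simple right `R`-module embeds into `R`) is classical: every element of `R` is
either a zero divisor or invertible.
Right `R`-modules are formalized as `Rᵐᵒᵖ`-modules.
-/

universe u

theorem classical_of_reversible_rightKasch
    (R : Type u) [Ring R]
    (hrev : ∀ a b : R, a * b = 0 → b * a = 0)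
    (hkasch : RightKasch R) :
    ∀ a : R, IsUnit a ∨ ∃ b : R, b ≠ 0 ∧ (a * b = 0 ∨ b * a = 0) := by
  intro a
  by_cases h : Submodule.span Rᵐᵒᵖ ({a} : Set R) = ⊤
  · left
    have h1 : (1 : R) ∈ Submodule.span Rᵐᵒᵖ ({a} : Set R) := by rw [h]; trivial
    obtain ⟨c, hc⟩ := Submodule.mem_span_singleton.1 h1
    have hab : a * c.unop = 1 := hc
    have h2 : a * (c.unop * a - 1) = 0 := by
      rw [mul_sub, ← mul_assoc, hab]; simp
    have h3 := hrev _ _ h2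
    have h4 : c.unop * a - 1 = 0 := by
      have h5 : (c.unop * a - 1) * a * c.unop = 0 := by rw [h3, zero_mul]
      rwa [mul_assoc, hab, mul_one] at h5
    exact ⟨⟨a, c.unop, hab, sub_eq_zero.1 h4⟩, rfl⟩
  · right
    have hfin : Module.Finite Rᵐᵒᵖ R := by
      refine ⟨⟨{1}, ?_⟩⟩
      rw [eq_top_iff]
      intro x _
      rw [Finset.coe_singleton]
      exact Submodule.mem_span_singleton.2 ⟨MulOpposite.op x, by simp⟩
    obtain ⟨M, hM, hle⟩ := (eq_top_or_exists_le_coatom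
      (Submodule.span Rᵐᵒᵖ ({a} : Set R))).resolve_left h
    have hs : IsSimpleModule Rᵐᵒᵖ (R ⧸ M) := isSimpleModule_iff_isCoatom.2 hM
    obtain ⟨f, hf⟩ := hkasch (R ⧸ M) hs
    have key : ∀ x : R, f (M.mkQ x) = f (M.mkQ 1) * x := by
      intro x
      have hx : x = MulOpposite.op x • (1 : R) := by simp
      conv_lhs => rw [hx, map_smul, map_smul]
      rfl
    refine ⟨f (M.mkQ 1), ?_, Or.inr ?_⟩
    · intro h0
      apply hM.1
      rw [eq_top_iff]
      intro x _
      have hx := key x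
      rw [h0, zero_mul] at hx
      have hx2 : M.mkQ x = 0 := hf (by rw [hx, map_zero])
      simpa using hx2
    · rw [← key a]
      have ha : M.mkQ a = 0 := by
        have := hle (Submodule.mem_span_singleton_self a)
        simpa using this
      rw [ha, map_zero]
end

section
/- Let R be a commutative ring with finite Goldie dimension, i.e. there is no infinite independent family of nonzero ideals of R (every family of nonzero ideals whose sum is direct is finite), and let E be an injective hull of R as an R-module. Then the following are equivalent: (a) R is dual Kasch, i.e. every simple R-module is a homomorphic image of an injective R-module; (b) R is classical, i.e. every element of R is either a zero divisor or invertible; (c) mE ≠ E for every maximal ideal m of R. -/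
/-!
STATEMENT 19: Let `R` be a commutative ring with finite Goldie dimension (every
independent family of nonzero ideals is finite) and let `E` be an injective hull of
`R` as an `R`-module. Then the following are equivalent:
(a) `R` is dual Kasch (every simple `R`-module is a homomorphic image of an injective
`R`-module);
(b) `R` is classical (every element is a zero divisor or invertible);
(c) `mE ≠ E` for every maximal ideal `m` of `R`.
-/

universe u

/-- uniform ideals -/
def UnifIdeal {R : Type u} [CommRing R] (U : Ideal R) : Prop :=
  U ≠ ⊥ ∧ ∀ A B : Ideal R, A ≤ U → B ≤ U → A ≠ ⊥ → B ≠ ⊥ → A ⊓ B ≠ ⊥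

lemma UnifIdeal.common {R : Type u} [CommRing R] {U : Ideal R} (hU : UnifIdeal U)
    {a b : R} (ha : a ∈ U) (hb : b ∈ U) (ha0 : a ≠ 0) (hb0 : b ≠ 0) :
    ∃ c ∈ U, c ≠ 0 ∧ a ∣ c ∧ b ∣ c := by
  have h := hU.2 (Ideal.span {a}) (Ideal.span {b})
    ((Ideal.span_singleton_le_iff_mem U).2 ha) ((Ideal.span_singleton_le_iff_mem U).2 hb)
    (by simpa using ha0) (by simpa using hb0)
  obtain ⟨c, hc, hc0⟩ := Submodule.exists_mem_ne_zero_of_ne_bot h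
  have h1 := Ideal.mem_span_singleton.1 hc.1
  have h2 := Ideal.mem_span_singleton.1 hc.2
  exact ⟨c, U.mem_of_dvd h1 ha, hc0, h1, h2⟩

/-- the associated prime of a uniform ideal -/
def UnifIdeal.prime {R : Type u} [CommRing R] {U : Ideal R} (hU : UnifIdeal U) : Ideal R where
  carrier := {r | ∃ x ∈ U, x ≠ 0 ∧ r * x = 0}
  zero_mem' := by
    obtain ⟨c, hc, hc0⟩ := Submodule.exists_mem_ne_zero_of_ne_bot hU.1
    exact ⟨c, hc, hc0, zero_mul _⟩
  add_mem' := by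
    rintro r s ⟨x, hx, hx0, hrx⟩ ⟨y, hy, hy0, hsy⟩
    obtain ⟨c, hc, hc0, ⟨p, hp⟩, ⟨q, hq⟩⟩ := hU.common hx hy hx0 hy0
    refine ⟨c, hc, hc0, ?_⟩
    have h1 : r * c = 0 := by rw [hp, ← mul_assoc, hrx, zero_mul]
    have h2 : s * c = 0 := by rw [hq, ← mul_assoc, hsy, zero_mul]
    rw [add_mul, h1, h2, add_zero]
  smul_mem' := by
    rintro c r ⟨x, hx, hx0, hrx⟩
    exact ⟨x, hx, hx0, by rw [smul_eq_mul, mul_assoc, hrx, mul_zero]⟩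

lemma UnifIdeal.mem_prime {R : Type u} [CommRing R] {U : Ideal R} (hU : UnifIdeal U) {r : R} :
    r ∈ hU.prime ↔ ∃ x ∈ U, x ≠ 0 ∧ r * x = 0 := Iff.rfl

lemma UnifIdeal.isPrime {R : Type u} [CommRing R] {U : Ideal R} (hU : UnifIdeal U) :
    hU.prime.IsPrime := by
  refine ⟨?_, ?_⟩
  · intro h
    obtain ⟨x, _, hx0, h1⟩ := hU.mem_prime.1 ((Ideal.eq_top_iff_one _).1 h)
    exact hx0 (by simpa using h1)
  · intro r s h
    obtain ⟨x, hx, hx0, h1⟩ := hU.mem_prime.1 h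
    by_cases hs : s * x = 0
    · exact Or.inr ⟨x, hx, hx0, hs⟩
    · exact Or.inl ⟨s * x, U.mul_mem_left s hx, hs, by rw [← mul_assoc, h1]⟩

lemma indep_of_tail {R : Type u} [CommRing R] (A J : ℕ → Ideal R)
    (hA : ∀ n, A n ≤ J n) (hJ : Antitone J) (hd : ∀ n, Disjoint (A n) (J (n + 1))) :
    iSupIndep A := by
  rw [iSupIndep_iff_finsetSum_eq_zero_imp_eq_zero]
  intro s v hv hsum n
  induction n using Nat.strong_induction_on with
  | _ n ih =>
    intro hn
    have h1 : ∑ k ∈ s.erase n, v k ∈ J (n + 1) := by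
      refine Submodule.sum_mem _ fun k hk => ?_
      obtain ⟨hkn, hks⟩ := Finset.mem_erase.1 hk
      rcases lt_or_gt_of_ne hkn with h | h
      · rw [ih k h hks]; exact zero_mem _
      · exact hJ h (hA k (hv k hks))
    rw [← Finset.add_sum_erase s v hn] at hsum
    have h2 : v n ∈ J (n + 1) := by
      rw [eq_neg_of_add_eq_zero_left hsum]; exact neg_mem h1
    exact (Submodule.disjoint_def.1 (hd n)) _ (hv n hn) h2

lemma exists_unif_le {R : Type u} [CommRing R]
    (hGoldie : ∀ (ι : Type u) (f : ι → Ideal R),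
      (∀ j, f j ≠ ⊥) → iSupIndep f → Finite ι) (N : Ideal R) (hN : N ≠ ⊥) :
    ∃ V ≤ N, UnifIdeal V := by
  by_contra! hcon
  let X := {K : Ideal R // K ≠ ⊥ ∧ K ≤ N}
  have key : ∀ K : X, ∃ A B : X, A.1 ≤ K.1 ∧ B.1 ≤ K.1 ∧ Disjoint A.1 B.1 := by
    rintro ⟨K, hK, hKN⟩
    have := hcon K hKN
    unfold UnifIdeal at this
    push Not at this
    obtain ⟨A, B, hAK, hBK, hA, hB, hAB⟩ := this hK
    exact ⟨⟨A, hA, hAK.trans hKN⟩, ⟨B, hB, hBK.trans hKN⟩, hAK, hBK, disjoint_iff.2 hAB⟩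
  choose fA fB h1 h2 h3 using key
  let J : ℕ → X := fun n => fB^[n] ⟨N, hN, le_rfl⟩
  have hJs : ∀ n, J (n + 1) = fB (J n) := fun n => Function.iterate_succ_apply' _ _ _
  have hind : iSupIndep (fun n => (fA (J n)).1) := by
    refine indep_of_tail _ (fun n => (J n).1) (fun n => h1 _) ?_ ?_
    · refine antitone_nat_of_succ_le fun n => ?_
      rw [hJs]; exact h2 _
    · intro n
      rw [hJs]; exact h3 _
  have hf := hGoldie (ULift.{u} ℕ) (fun n => (fA (J n.down)).1) (fun n => (fA (J n.down)).2.1)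
    (hind.comp ULift.down_injective)
  exact not_finite (ULift.{u} ℕ)

lemma sSupIndep_insert_of_disjoint {R : Type u} [CommRing R] {s : Set (Ideal R)} {V : Ideal R}
    (hs : sSupIndep s) (hV : Disjoint V (sSup s)) : sSupIndep (insert V s) := by
  intro x hx
  by_cases hxV : x = V
  · subst hxV
    refine hV.mono_right (sSup_le_sSup ?_)
    rintro y ⟨rfl | hy, hne⟩
    · exact absurd rfl hne
    · exact hy
  · have hxs : x ∈ s := hx.resolve_left hxV
    have hle : sSup (insert V s \ {x}) ≤ sSup (s \ {x}) ⊔ V := by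
      refine sSup_le ?_
      rintro y ⟨rfl | hy, hne⟩
      · exact le_sup_right
      · exact (le_sSup (show y ∈ s \ {x} from ⟨hy, hne⟩)).trans le_sup_left
    refine Disjoint.mono_right hle ?_
    refine Disjoint.disjoint_sup_right_of_disjoint_sup_left (hs hxs) ?_
    refine hV.symm.mono_left (sup_le (le_sSup hxs) (sSup_le_sSup Set.sdiff_subset))

lemma exists_family {R : Type u} [CommRing R]
    (hGoldie : ∀ (ι : Type u) (f : ι → Ideal R),
      (∀ j, f j ≠ ⊥) → iSupIndep f → Finite ι) :
    ∃ s : Set (Ideal R), s.Finite ∧ sSupIndep s ∧ (∀ U ∈ s, UnifIdeal U) ∧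
      ∀ N : Ideal R, N ≠ ⊥ → N ⊓ sSup s ≠ ⊥ := by
  obtain ⟨s, hs⟩ := zorn_subset {s : Set (Ideal R) | sSupIndep s ∧ ∀ U ∈ s, UnifIdeal U} (by
    intro c hc hchain
    refine ⟨⋃₀ c, ⟨?_, ?_⟩, fun t ht => Set.subset_sUnion_of_mem ht⟩
    · exact iSupIndep_sUnion_of_directed hchain.directedOn fun t ht => (hc ht).1
    · rintro U ⟨t, ht, hU⟩
      exact (hc ht).2 U hU)
  refine ⟨s, ?_, hs.prop.1, hs.prop.2, ?_⟩
  · exact Set.finite_coe_iff.1 (hGoldie s (fun U => U.1) (fun U => (hs.prop.2 U.1 U.2).1) ((sSupIndep_iff s).1 hs.prop.1))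
  · intro N hN hbot
    obtain ⟨V, hVN, hV⟩ := exists_unif_le hGoldie N hN
    have hd : Disjoint V (sSup s) := (disjoint_iff.2 hbot).mono_left hVN
    have hmem : V ∈ s := by
      refine hs.le_of_ge (y := insert V s) ⟨sSupIndep_insert_of_disjoint hs.prop.1 hd, ?_⟩
        (Set.subset_insert _ _) (Set.mem_insert _ _)
      rintro U (rfl | hU)
      · exact hV
      · exact hs.prop.2 U hU
    exact hV.1 (disjoint_self.1 (hd.mono_right (le_sSup hmem)))

lemma exists_unif_of_zeroDivisors {R : Type u} [CommRing R]
    (hGoldie : ∀ (ι : Type u) (f : ι → Ideal R),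
      (∀ j, f j ≠ ⊥) → iSupIndep f → Finite ι) (m : Ideal R)
    (hm : ∀ a ∈ m, ∃ b : R, b ≠ 0 ∧ a * b = 0) :
    ∃ (U : Ideal R) (hU : UnifIdeal U), m ≤ hU.prime := by
  classical
  obtain ⟨s, hfin, hind, hunif, hess⟩ := exists_family hGoldie
  have : Fintype s := hfin.fintype
  have hsub : (m : Set R) ⊆ ⋃ U ∈ (↑(Finset.univ : Finset s) : Set s),
      ((hunif U.1 U.2).prime : Set R) := by
    intro r hr
    obtain ⟨b, hb0, hb⟩ := hm r hr
    have hN : LinearMap.ker (LinearMap.mulLeft R r) ≠ ⊥ :=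
      fun h => hb0 ((Submodule.eq_bot_iff _).1 h b (by simpa using hb))
    obtain ⟨x, ⟨hxN, hxs⟩, hx0⟩ := Submodule.exists_mem_ne_zero_of_ne_bot (hess _ hN)
    have hrx : r * x = 0 := by simpa using hxN
    have hxs' : x ∈ ⨆ U : s, U.1 := by rw [← sSup_eq_iSup']; exact hxs
    obtain ⟨v, hv⟩ := (Submodule.mem_iSup_iff_exists_finsupp _ _).1 hxs'
    obtain ⟨hv, hvx⟩ := hv
    have hI := (iSupIndep_iff_finsetSum_eq_zero_imp_eq_zero _).1 ((sSupIndep_iff s).1 hind)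
    have hz := hI v.support (fun U => r * v U) (fun U _ => Ideal.mul_mem_left _ _ (hv U)) (by
      rw [← Finset.mul_sum]
      rw [Finsupp.sum] at hvx
      rw [hvx, hrx])
    have hne : v ≠ 0 := by
      rintro rfl
      exact hx0 (by rw [← hvx]; simp)
    obtain ⟨U, hU⟩ := Finsupp.ne_iff.1 hne
    simp only [Finset.coe_univ, Set.mem_univ, Set.iUnion_true, Set.mem_iUnion]
    exact ⟨U, v U, hv U, hU, hz U (Finsupp.mem_support_iff.2 hU)⟩
  by_cases hemp : Nonempty s
  · obtain ⟨a⟩ := hemp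
    obtain ⟨U, _, hU⟩ := (Ideal.subset_union_prime a a
      (fun U _ _ _ => (hunif U.1 U.2).isPrime)).1 hsub
    exact ⟨U.1, hunif U.1 U.2, hU⟩
  · obtain ⟨U, _⟩ := Set.mem_iUnion.1 (hsub m.zero_mem)
    exact absurd ⟨U⟩ hemp

lemma exists_field_functional {K : Type u} [Field K] {V : Type u} [AddCommGroup V] [Module K V]
    {v : V} (hv : v ≠ 0) : ∃ φ : V →ₗ[K] K, φ v ≠ 0 := by
  by_contra! hc
  exact hv ((Module.forall_dual_apply_eq_zero_iff K _).1 hc)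

lemma exists_functional {K : Type u} [inst : CommRing K] (hK : IsField K)
    {V : Type u} [AddCommGroup V] [Module K V]
    {v : V} (hv : v ≠ 0) : ∃ φ : V →ₗ[K] K, φ v ≠ 0 := by
  obtain ⟨F, hF⟩ : ∃ F : Field K, F.toCommRing = inst := ⟨hK.toField, rfl⟩
  subst hF
  exact exists_field_functional hv

theorem commutative_finiteGoldie_dualKasch_tfae
    (R : Type u) [CommRing R]
    -- finite Goldie dimension: no infinite independent family of nonzero ideals
    (hGoldie : ∀ (ι : Type u) (f : ι → Ideal R),
      (∀ j, f j ≠ ⊥) → iSupIndep f → Finite ι)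
    (E : Type u) [AddCommGroup E] [Module R E]
    (hE : Module.Injective R E) (i : R →ₗ[R] E) (hi : Function.Injective i)
    (hess : ∀ K : Submodule R E, K ≠ ⊥ → K ⊓ LinearMap.range i ≠ ⊥) :
    List.TFAE [
      -- (a) `R` is dual Kasch
      ∀ (S : Type u) [AddCommGroup S] [Module R S], IsSimpleModule R S →
        ∃ (Q : Type u) (_ : AddCommGroup Q) (_ : Module R Q),
          Module.Injective R Q ∧ ∃ f : Q →ₗ[R] S, Function.Surjective f,
      -- (b) `R` is classical
      ∀ a : R, IsUnit a ∨ ∃ b : R, b ≠ 0 ∧ a * b = 0,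
      -- (c) `mE ≠ E` for every maximal ideal `m`
      ∀ m : Ideal R, m.IsMaximal → m • (⊤ : Submodule R E) ≠ ⊤] := by
  tfae_have 1 → 2 := by
    intro h a
    by_contra! hcon
    obtain ⟨hu, hreg⟩ := hcon
    obtain ⟨m, hm, ham⟩ := exists_max_ideal_of_mem_nonunits hu
    obtain ⟨Q, _, _, hQ, f, hf⟩ := h (R ⧸ m)
      (isSimpleModule_iff_quot_maximal.2 ⟨m, hm, ⟨LinearEquiv.refl R _⟩⟩)
    obtain ⟨q, hq⟩ := hf 1
    obtain ⟨g, hg⟩ := hQ.out (LinearMap.mulLeft R a)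
      ((injective_iff_map_eq_zero _).2 fun x hx => by
        by_contra hx0
        exact hreg x hx0 (by simpa using hx)) (LinearMap.toSpanSingleton R Q q)
    have h1 : a • g 1 = q := by
      have := hg 1
      simp only [LinearMap.mulLeft_apply, LinearMap.toSpanSingleton_apply, one_smul] at this
      rw [← map_smul, smul_eq_mul, this]
    have h2 : (1 : R ⧸ m) = 0 := by
      rw [← hq, ← h1, map_smul, Algebra.smul_def, Ideal.Quotient.algebraMap_eq,
        Ideal.Quotient.eq_zero_iff_mem.2 ham, zero_mul]
    exact hm.ne_top ((Ideal.eq_top_iff_one m).2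
      (Ideal.Quotient.eq_zero_iff_mem.1 h2))
  tfae_have 2 → 3 := by
    intro h m hm htop
    obtain ⟨U, hU, hmU⟩ := exists_unif_of_zeroDivisors hGoldie m (fun a ha =>
      (h a).resolve_left fun hu => hm.ne_top (m.eq_top_of_isUnit_mem ha hu))
    have key : ∀ e ∈ m • (⊤ : Submodule R E), ∃ x ∈ U, x ≠ 0 ∧ x • e = 0 := by
      intro e he
      refine Submodule.smul_induction_on he ?_ ?_
      · intro r hr y _
        obtain ⟨x, hx, hx0, hrx⟩ := hU.mem_prime.1 (hmU hr)
        exact ⟨x, hx, hx0, by rw [smul_smul, mul_comm, hrx, zero_smul]⟩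
      · rintro y z ⟨a, ha, ha0, hay⟩ ⟨b, hb, hb0, hbz⟩
        obtain ⟨c, hc, hc0, ⟨p, hp⟩, ⟨q, hq⟩⟩ := hU.common ha hb ha0 hb0
        refine ⟨c, hc, hc0, ?_⟩
        have h1 : c • y = 0 := by rw [hp, mul_comm, mul_smul, hay, smul_zero]
        have h2 : c • z = 0 := by rw [hq, mul_comm, mul_smul, hbz, smul_zero]
        rw [smul_add, h1, h2, add_zero]
    obtain ⟨x, _, hx0, hx⟩ := key (i 1) (by rw [htop]; trivial)
    apply hx0
    apply hi
    rw [map_zero, ← hx, ← map_smul, smul_eq_mul, mul_one]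
  tfae_have 3 → 1 := by
    intro h S _ _ hS
    refine ⟨E, inferInstance, inferInstance, hE, ?_⟩
    obtain ⟨m, hm, ⟨e⟩⟩ := isSimpleModule_iff_quot_maximal.1 hS
    have hne := h m hm
    obtain ⟨v, hv⟩ : ∃ v : E, v ∉ m • (⊤ : Submodule R E) := by
      by_contra! hc
      exact hne (eq_top_iff.2 fun x _ => hc x)
    have hv' : (Submodule.Quotient.mk v : E ⧸ m • (⊤ : Submodule R E)) ≠ 0 :=
      fun h0 => hv ((Submodule.Quotient.mk_eq_zero _).1 h0)
    obtain ⟨φ, hφ⟩ : ∃ φ : Module.Dual (R ⧸ m) (E ⧸ m • (⊤ : Submodule R E)),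
        φ (Submodule.Quotient.mk v) ≠ 0 :=
      exists_functional ((Ideal.Quotient.maximal_ideal_iff_isField_quotient m).1 hm) hv'
    let g : E →ₗ[R] S := e.symm.toLinearMap ∘ₗ
      (φ.restrictScalars R) ∘ₗ (Submodule.mkQ (m • (⊤ : Submodule R E)))
    refine ⟨g, LinearMap.surjective_of_ne_zero fun hg => hφ ?_⟩
    have : g v = 0 := by rw [hg]; rfl
    exact (LinearEquiv.map_eq_zero_iff e.symm).1 this
  tfae_finish
end
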